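/- Let a and m be positive integers. There exists an infinite set S of pairs (t,r) of non-negative integers with r < t such that: (a) for every (t,r) ∈ S and every non-negative integer n, m divides both M(a; tn+r) and MO(a; tn+r); and (b) for distinct (t,r), (t′,r′) ∈ S the set {tn+r : n ∈ ℕ} is not contained in {t′n+r′ : n ∈ ℕ}. -/

import Mathlib

open Finset

/-- `MO a n` is MacMahon's coefficient: the sum of the products `s_1 ⋯ s_a` over all
strictly increasing tuples `0 < k_1 < ⋯ < k_a` of positive integers and positive
integers `s_1, …, s_a` with `s_1*k_1 + ⋯ + s_a*k_a = n` (all such data satisfy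
`k_i, s_i ≤ n`, so we may sum over a finite set); in particular `MO a 0 = 0` for `a ≥ 1`. -/
def MO (a n : ℕ) : ℕ :=
  ∑ f ∈ Finset.univ.filter (fun f : Fin a → Fin (n + 1) × Fin (n + 1) =>
      (∀ i, 0 < ((f i).1 : ℕ) ∧ 0 < ((f i).2 : ℕ)) ∧
      (∀ i j : Fin a, i < j → (f i).1 < (f j).1) ∧
      (∑ i, ((f i).2 : ℕ) * ((f i).1 : ℕ)) = n),
    ∏ i, ((f i).2 : ℕ)

/-- `M a n` is the coefficient of Amdeberhan-Andrews-Tauraso: the sum of the products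
`s_1 ⋯ s_a` over all weakly increasing tuples `1 ≤ k_1 ≤ ⋯ ≤ k_a` of positive integers
and positive integers `s_1, …, s_a` with `s_1*k_1 + ⋯ + s_a*k_a = n`;
in particular `M a 0 = 0` for `a ≥ 1`. -/
def M (a n : ℕ) : ℕ :=
  ∑ f ∈ Finset.univ.filter (fun f : Fin a → Fin (n + 1) × Fin (n + 1) =>
      (∀ i, 0 < ((f i).1 : ℕ) ∧ 0 < ((f i).2 : ℕ)) ∧
      (∀ i j : Fin a, i ≤ j → (f i).1 ≤ (f j).1) ∧
      (∑ i, ((f i).2 : ℕ) * ((f i).1 : ℕ)) = n),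
    ∏ i, ((f i).2 : ℕ)

/-- The arithmetic progression `{t*n + r : n ∈ ℕ}` attached to a pair `(t, r)`. -/
def AP (p : ℕ × ℕ) : Set ℕ := {x | ∃ n : ℕ, x = p.1 * n + p.2}

namespace QuasiModular

open UpperHalfPlane Polynomial Complex Filter Topology
open scoped MatrixGroups Real

/-- The nome `exp (2 π i z)`. -/
noncomputable def nome (z : ℂ) : ℂ := cexp (2 * π * Complex.I * z)

lemma nome_eq_qParam (z : ℂ) : nome z = Function.Periodic.qParam 1 z := by
  simp [nome, Function.Periodic.qParam]

lemma nome_natCast_mul (n : ℕ) (z : ℂ) : nome (n * z) = nome z ^ n := by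
  rw [nome, nome, ← Complex.exp_nat_mul]
  congr 1
  ring

/-- The value at `(z, X)` of the `q`-series with polynomial coefficients `a`. -/
noncomputable def evalSeries (a : ℕ → ℂ[X]) (z X : ℂ) : ℂ := ∑' n, (a n).eval X * nome z ^ n

/-- The transformation law of weight `k` under `γ`, for functions on `ℍ × ℂ` on which `SL(2, ℤ)`
acts by `(τ, X) ↦ (γ τ, j² X + c j)` with `j = c τ + d`. -/
def TransformsUnder (F : ℂ → ℂ → ℂ) (k : ℕ) (γ : SL(2, ℤ)) : Prop :=
  ∀ (τ : ℍ) (X : ℂ), F (γ • τ : ℍ) (denom γ τ ^ 2 * X + γ 1 0 * denom γ τ) =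
    denom γ τ ^ k * F τ X

lemma denom_mul (γ δ : SL(2, ℤ)) (τ : ℍ) :
    denom ((γ * δ : SL(2, ℤ)) : GL (Fin 2) ℝ) τ = denom γ (δ • τ : ℍ) * denom δ τ := by
  have h := denom_cocycle (γ : GL (Fin 2) ℝ) (δ : GL (Fin 2) ℝ) τ.im_ne_zero
  rw [← map_mul, ← map_mul] at h
  rw [h, specialLinearGroup_apply]
  simp [denom, num]

lemma TransformsUnder.mul {F : ℂ → ℂ → ℂ} {k : ℕ} {γ δ : SL(2, ℤ)} (hγ : TransformsUnder F k γ)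
    (hδ : TransformsUnder F k δ) : TransformsUnder F k (γ * δ) := by
  intro τ X
  have hco : denom ((γ * δ : SL(2, ℤ)) : GL (Fin 2) ℝ) τ =
      denom γ (δ • τ : ℍ) * denom δ τ := denom_mul γ δ τ
  have h := hγ (δ • τ) (denom δ τ ^ 2 * X + δ 1 0 * denom δ τ)
  rw [hδ τ X, ← mul_smul, ← mul_assoc, ← mul_pow, ← hco] at h
  rw [← h]
  congr 1
  have hdet := δ.det_coe
  rw [Matrix.det_fin_two] at hdet
  have hdet' : (δ 0 0 : ℂ) * δ 1 1 - δ 0 1 * δ 1 0 = 1 := by exact_mod_cast hdet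
  have key : ((γ * δ) 1 0 : ℂ) * denom δ τ =
      γ 1 0 + δ 1 0 * denom ((γ * δ : SL(2, ℤ)) : GL (Fin 2) ℝ) τ := by
    rw [ModularGroup.denom_apply, ModularGroup.denom_apply]
    simp only [Matrix.SpecialLinearGroup.coe_mul, Matrix.mul_apply, Fin.sum_univ_two]
    push_cast
    linear_combination (γ 1 0 : ℂ) * hdet'
  rw [hco] at key ⊢
  linear_combination denom (γ : GL (Fin 2) ℝ) (δ • τ : ℍ) * key

lemma TransformsUnder.inv {F : ℂ → ℂ → ℂ} {k : ℕ} {γ : SL(2, ℤ)} (hγ : TransformsUnder F k γ) :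
    TransformsUnder F k γ⁻¹ := by
  intro τ X
  have hco : denom (γ : GL (Fin 2) ℝ) (γ⁻¹ • τ : ℍ) * denom (γ⁻¹ : SL(2, ℤ)) τ = 1 := by
    rw [← denom_mul]
    simp
  have h := hγ (γ⁻¹ • τ) (denom (γ⁻¹ : SL(2, ℤ)) τ ^ 2 * X +
    γ⁻¹ 1 0 * denom (γ⁻¹ : SL(2, ℤ)) τ)
  rw [smul_inv_smul] at h
  have hc : γ⁻¹ 1 0 = -γ 1 0 := by
    simp [Matrix.SpecialLinearGroup.coe_inv, Matrix.adjugate_fin_two]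
  have hX : denom (γ : GL (Fin 2) ℝ) (γ⁻¹ • τ : ℍ) ^ 2 *
      (denom (γ⁻¹ : SL(2, ℤ)) τ ^ 2 * X + γ⁻¹ 1 0 * denom (γ⁻¹ : SL(2, ℤ)) τ) +
      γ 1 0 * denom (γ : GL (Fin 2) ℝ) (γ⁻¹ • τ : ℍ) = X := by
    rw [hc]
    push_cast
    linear_combination (X * (denom (γ : GL (Fin 2) ℝ) (γ⁻¹ • τ : ℍ) *
      denom (γ⁻¹ : SL(2, ℤ)) τ + 1) - γ 1 0 * denom (γ : GL (Fin 2) ℝ) (γ⁻¹ • τ : ℍ)) * hco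
  rw [hX] at h
  rw [h, ← mul_assoc, ← mul_pow, mul_comm (denom _ _), hco, one_pow, one_mul]

lemma transformsUnder_of_S_T {F : ℂ → ℂ → ℂ} {k : ℕ} (hS : TransformsUnder F k ModularGroup.S)
    (hT : TransformsUnder F k ModularGroup.T) (γ : SL(2, ℤ)) : TransformsUnder F k γ := by
  have hγ : γ ∈ Subgroup.closure {ModularGroup.S, ModularGroup.T} := by
    rw [SpecialLinearGroup.SL2Z_generators]; trivial
  induction hγ using Subgroup.closure_induction with
  | mem x hx => rcases hx with rfl | rfl <;> assumption
  | one =>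
    intro τ X
    simp
  | mul x y _ _ hx hy => exact hx.mul hy
  | inv x _ hx => exact hx.inv

lemma transformsUnder_S_iff {F : ℂ → ℂ → ℂ} {k : ℕ} :
    TransformsUnder F k ModularGroup.S ↔
      ∀ (τ : ℍ) (X : ℂ), F (-1 / τ) (τ ^ 2 * X + τ) = τ ^ k * F τ X := by
  have h10 : ModularGroup.S 1 0 = 1 := rfl
  simp only [TransformsUnder, UpperHalfPlane.modular_S_smul]
  simp [h10, neg_div, ← inv_neg]

lemma transformsUnder_T_iff {F : ℂ → ℂ → ℂ} {k : ℕ} :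
    TransformsUnder F k ModularGroup.T ↔ ∀ (τ : ℍ) (X : ℂ), F (τ + 1) X = F τ X := by
  have h10 : ModularGroup.T 1 0 = 0 := rfl
  have h11 : ModularGroup.T 1 1 = 1 := rfl
  simp only [TransformsUnder, UpperHalfPlane.modular_T_smul]
  simp [ModularGroup.denom_apply, h10, h11, add_comm]

/-- The `q`-series `a` with coefficients in `ℂ[X]` is quasimodular of weight `k` and depth less
than `p`. -/
structure IsQuasiModular (k p : ℕ) (a : ℕ → ℂ[X]) : Prop where
  coeff_mem : ∀ n, a n ∈ degreeLT ℂ p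
  summable : ∀ (τ : ℍ) (X : ℂ), Summable fun n ↦ ‖(a n).eval X * nome τ ^ n‖
  transforms : ∀ γ, TransformsUnder (evalSeries a) k γ

lemma IsQuasiModular.mul {k l p r : ℕ} {a b : ℕ → ℂ[X]} (ha : IsQuasiModular k p a)
    (hb : IsQuasiModular l r b) :
    IsQuasiModular (k + l) (p + r) (fun n ↦ ∑ x ∈ antidiagonal n, a x.1 * b x.2) := by
  have hterm : ∀ (τ : ℍ) (X : ℂ) (n : ℕ),
      (∑ x ∈ antidiagonal n, a x.1 * b x.2).eval X * nome τ ^ n =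
      ∑ x ∈ antidiagonal n, ((a x.1).eval X * nome τ ^ x.1) * ((b x.2).eval X * nome τ ^ x.2) := by
    intro τ X n
    rw [eval_finsetSum, Finset.sum_mul]
    refine Finset.sum_congr rfl fun x hx ↦ ?_
    rw [← mem_antidiagonal.mp hx, pow_add, eval_mul]
    ring
  have hval : ∀ (τ : ℍ) (X : ℂ), evalSeries (fun n ↦ ∑ x ∈ antidiagonal n, a x.1 * b x.2) τ X =
      evalSeries a τ X * evalSeries b τ X := by
    intro τ X
    rw [evalSeries, evalSeries, evalSeries,
      tsum_mul_tsum_eq_tsum_sum_antidiagonal_of_summable_norm (ha.summable τ X) (hb.summable τ X)]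
    exact tsum_congr fun n ↦ hterm τ X n
  refine ⟨fun n ↦ Submodule.sum_mem _ fun x _ ↦ ?_, fun τ X ↦ ?_, fun γ τ X ↦ ?_⟩
  · have h1 := mem_degreeLT.mp (ha.coeff_mem x.1)
    have h2 := mem_degreeLT.mp (hb.coeff_mem x.2)
    by_cases h0 : a x.1 = 0
    · simp [h0]
    by_cases h0' : b x.2 = 0
    · simp [h0']
    rw [mem_degreeLT, degree_mul, Polynomial.degree_eq_natDegree h0,
      Polynomial.degree_eq_natDegree h0'] at *
    norm_cast at *
    omega
  · refine (summable_norm_sum_mul_antidiagonal_of_summable_norm (ha.summable τ X)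
      (hb.summable τ X)).congr fun n ↦ ?_
    rw [hterm]
  · rw [hval, hval, ha.transforms γ τ X, hb.transforms γ τ X]
    ring

lemma evalSeries_add_one (a : ℕ → ℂ[X]) (z X : ℂ) : evalSeries a (z + 1) X = evalSeries a z X := by
  have : nome (z + 1) = nome z := by
    rw [nome, nome, mul_add, mul_one]
    exact Complex.exp_periodic _
  simp [evalSeries, this]

/-- Quasimodular `q`-series of weight `k` and depth less than `p`. -/
def quasiModularSubmodule (k p : ℕ) : Submodule ℂ (ℕ → ℂ[X]) where
  carrier := {a | IsQuasiModular k p a}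
  zero_mem' := ⟨fun n ↦ by simp, fun τ X ↦ by simp [summable_zero],
    fun γ τ X ↦ by simp [evalSeries]⟩
  add_mem' {a b} ha hb := by
    have hval : ∀ (τ : ℍ) (X : ℂ),
        evalSeries (a + b) τ X = evalSeries a τ X + evalSeries b τ X := by
      intro τ X
      rw [evalSeries, evalSeries, evalSeries,
        ← ((ha.summable τ X).of_norm).tsum_add ((hb.summable τ X).of_norm)]
      simp [add_mul]
    refine ⟨fun n ↦ Submodule.add_mem _ (ha.coeff_mem n) (hb.coeff_mem n),
      fun τ X ↦ ?_, fun γ τ X ↦ ?_⟩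
    · refine Summable.of_nonneg_of_le (fun _ ↦ norm_nonneg _) (fun n ↦ ?_)
        ((ha.summable τ X).add (hb.summable τ X))
      simp only [Pi.add_apply, eval_add, add_mul]
      exact norm_add_le _ _
    · rw [hval, hval, ha.transforms γ τ X, hb.transforms γ τ X]
      ring
  smul_mem' c a ha := by
    have hval : ∀ (τ : ℍ) (X : ℂ), evalSeries (c • a) τ X = c * evalSeries a τ X := by
      intro τ X
      simp [evalSeries, ← tsum_mul_left, mul_assoc]
    refine ⟨fun n ↦ Submodule.smul_mem _ c (ha.coeff_mem n), fun τ X ↦ ?_, fun γ τ X ↦ ?_⟩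
    · simpa [mul_assoc] using (ha.summable τ X).mul_left ‖c‖
    · rw [hval, hval, ha.transforms γ τ X]
      ring

open scoped Manifold ModularForm

/-- The `q`-series formed by the coefficients of `X ^ j`. -/
noncomputable def coeffSeries (a : ℕ → ℂ[X]) (j : ℕ) (z : ℂ) : ℂ :=
  ∑' n, (a n).coeff j * nome z ^ n

lemma coeff_eq_sum_eval {p : ℕ} {f : ℂ[X]} (hf : f ∈ degreeLT ℂ p) (j : ℕ) :
    f.coeff j = ∑ i ∈ range p,
      f.eval (i : ℂ) * (Lagrange.basis (range p) (fun i : ℕ ↦ (i : ℂ)) i).coeff j := by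
  have h := Lagrange.eq_interpolate (s := range p) (v := fun i : ℕ ↦ (i : ℂ)) (f := f)
    (fun x _ y _ h ↦ Nat.cast_injective h) (by simpa using mem_degreeLT.mp hf)
  conv_lhs => rw [h, Lagrange.interpolate_apply, finsetSum_coeff]
  simp

lemma eval_eq_sum_of_mem_degreeLT {p : ℕ} {f : ℂ[X]} (hf : f ∈ degreeLT ℂ p) (x : ℂ) :
    f.eval x = ∑ j ∈ range p, f.coeff j * x ^ j := by
  rw [Polynomial.eval_eq_sum, ← Polynomial.sum_fin _ (by simp) (mem_degreeLT.mp hf),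
    Fin.sum_univ_eq_sum_range (fun j ↦ f.coeff j * x ^ j)]

section

variable {k p : ℕ} {a : ℕ → ℂ[X]}

lemma IsQuasiModular.summable_coeff (ha : IsQuasiModular k p a) (j : ℕ) (τ : ℍ) :
    Summable fun n ↦ ‖(a n).coeff j * nome τ ^ n‖ := by
  refine Summable.of_nonneg_of_le (fun _ ↦ norm_nonneg _) (fun n ↦ ?_)
    (summable_sum (s := range p) fun i _ ↦ (ha.summable τ i).mul_right
      ‖(Lagrange.basis (range p) (fun i : ℕ ↦ (i : ℂ)) i).coeff j‖)
  rw [coeff_eq_sum_eval (ha.coeff_mem n), Finset.sum_mul]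
  refine (norm_sum_le _ _).trans (Finset.sum_le_sum fun i _ ↦ ?_)
  rw [← norm_mul]
  exact le_of_eq (congrArg _ (by ring))

lemma IsQuasiModular.evalSeries_eq_sum (ha : IsQuasiModular k p a) (τ : ℍ) (X : ℂ) :
    evalSeries a τ X = ∑ j ∈ range p, coeffSeries a j τ * X ^ j := by
  have h : ∀ n, (a n).eval X * nome τ ^ n =
      ∑ j ∈ range p, (a n).coeff j * nome τ ^ n * X ^ j := by
    intro n
    rw [eval_eq_sum_of_mem_degreeLT (ha.coeff_mem n), Finset.sum_mul]
    exact Finset.sum_congr rfl fun j _ ↦ by ring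
  rw [evalSeries, tsum_congr h, Summable.tsum_finsetSum]
  · simp only [coeffSeries, tsum_mul_right]
  · exact fun j _ ↦ ((ha.summable_coeff j τ).of_norm).mul_right _

lemma IsQuasiModular.coeffSeries_smul (ha : IsQuasiModular k (p + 1) a) (γ : SL(2, ℤ)) (τ : ℍ) :
    coeffSeries a p (γ • τ : ℍ) * denom γ τ ^ (2 * p) = denom γ τ ^ k * coeffSeries a p τ := by
  have key : ∑ j ∈ range (p + 1), C (coeffSeries a j (γ • τ : ℍ)) *
      (C (denom γ τ ^ 2) * X + C (γ 1 0 * denom γ τ)) ^ j =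
      C (denom γ τ ^ k) * ∑ j ∈ range (p + 1), C (coeffSeries a j τ) * X ^ j := by
    refine Polynomial.funext fun x ↦ ?_
    have h := ha.transforms γ τ x
    rw [ha.evalSeries_eq_sum, ha.evalSeries_eq_sum] at h
    simpa [eval_finsetSum] using h
  have hdeg : (C (denom γ τ ^ 2) * X + C (γ 1 0 * denom γ τ) : ℂ[X]).natDegree ≤ 1 :=
    natDegree_linear_le
  have h := congrArg (fun f ↦ coeff f p) key
  simp only [finsetSum_coeff, coeff_C_mul] at h
  rw [Finset.sum_range_succ, Finset.sum_eq_zero, Finset.sum_eq_single p] at h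
  · have h1 := coeff_pow_of_natDegree_le (m := p) hdeg
    rw [mul_one, coeff_add, coeff_C_mul, coeff_X_one, coeff_C_succ, mul_one, add_zero,
      ← pow_mul] at h1
    rw [h1, coeff_X_pow_self, mul_one, zero_add] at h
    exact h
  · intro j _ hj
    simp [coeff_X_pow, hj.symm]
  · simp
  · intro j hj
    rw [coeff_eq_zero_of_natDegree_lt, mul_zero]
    refine (natDegree_pow_le_of_le j hdeg).trans_lt ?_
    simpa using hj

lemma IsQuasiModular.differentiableOn_coeffSeries (ha : IsQuasiModular k p a) (j : ℕ) :
    DifferentiableOn ℂ (coeffSeries a j) {z | 0 < z.im} := by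
  intro z hz
  have hz : 0 < z.im := hz
  let τ : ℍ := ⟨(z.im / 2 : ℝ) * Complex.I, by simpa using hz⟩
  have hU : IsOpen {w : ℂ | z.im / 2 < w.im} := isOpen_lt continuous_const continuous_im
  have hd : DifferentiableOn ℂ (coeffSeries a j) {w : ℂ | z.im / 2 < w.im} := by
    refine differentiableOn_tsum_of_summable_norm (ha.summable_coeff j τ) (fun n ↦ ?_) hU ?_
    · refine Differentiable.differentiableOn ?_
      simp only [nome]
      fun_prop
    · intro n w hw
      rw [norm_mul, norm_mul, norm_pow, norm_pow]
      gcongr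
      rw [nome, nome, Complex.norm_exp, Complex.norm_exp, Real.exp_le_exp]
      have hw : z.im / 2 < w.im := hw
      simp [τ]
      nlinarith [Real.pi_pos]
  refine (hd.differentiableAt (hU.mem_nhds ?_)).differentiableWithinAt
  simpa using hz

/-- The leading coefficient of a quasimodular series, as a modular form. -/
noncomputable def IsQuasiModular.leadingForm (ha : IsQuasiModular k (p + 1) a) :
    ModularForm 𝒮ℒ ((k : ℤ) - 2 * p) :=
  have hslash : ∀ γ : SL(2, ℤ), (fun τ : ℍ ↦ coeffSeries a p τ) ∣[(k : ℤ) - 2 * p] γ =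
      fun τ : ℍ ↦ coeffSeries a p τ := by
    intro γ
    funext τ
    have h0 : denom γ τ ≠ 0 := denom_ne_zero γ τ
    rw [ModularForm.SL_slash_apply, neg_sub, zpow_sub₀ h0, mul_div_assoc', div_eq_iff (by simp [h0])]
    have := ha.coeffSeries_smul γ τ
    rw [mul_comm (coeffSeries a p (τ : ℂ))]
    exact_mod_cast this
  { toFun := fun τ ↦ coeffSeries a p τ
    slash_action_eq' := fun _ ⟨γ, hγ⟩ ↦ hγ ▸ hslash γ
    holo' := by
      refine UpperHalfPlane.mdifferentiable_iff.mpr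
        ((ha.differentiableOn_coeffSeries p).congr fun z hz ↦ ?_)
      simp [Function.comp_apply, ofComplex_apply_of_im_pos hz]
    bdd_at_cusps' := by
      intro c hc
      rw [Subgroup.IsArithmetic.isCusp_iff_isCusp_SL2Z] at hc
      rw [OnePoint.isBoundedAt_iff_forall_SL2Z hc]
      intro γ _
      rw [hslash]
      refine isBoundedAtImInfty_of_hasSum_qExpansion one_pos (c := fun n ↦ (a n).coeff p)
        fun τ ↦ ?_
      simp_rw [← nome_eq_qParam]
      exact ((ha.summable_coeff p τ).of_norm).hasSum }

lemma IsQuasiModular.coeff_leadingForm (ha : IsQuasiModular k (p + 1) a) (n : ℕ) :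
    (qExpansion 1 ha.leadingForm).coeff n = (a n).coeff p := by
  refine (ModularFormClass.qExpansion_coeff_unique (c := fun n ↦ (a n).coeff p) one_pos
    one_mem_strictPeriods_SL (fun τ ↦ ?_) n).symm
  simp_rw [← nome_eq_qParam]
  exact ((ha.summable_coeff p τ).of_norm).hasSum

end

/-- Taking the coefficients of the `q`-expansion of a modular form of level one. -/
noncomputable def qExpansionCoeffs (k : ℤ) : ModularForm 𝒮ℒ k →ₗ[ℂ] (ℕ → ℂ) where
  toFun f n := (qExpansion 1 f).coeff n
  map_add' f g := by
    funext n
    simp [ModularForm.qExpansion_add one_pos one_mem_strictPeriods_SL f g]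
  map_smul' c f := by
    funext n
    simp [ModularForm.qExpansion_smul one_pos one_mem_strictPeriods_SL c f]

/-- The coefficients of `X ^ j`, as a linear map. -/
noncomputable def coeffMap (j : ℕ) : (ℕ → ℂ[X]) →ₗ[ℂ] (ℕ → ℂ) :=
  LinearMap.pi fun n ↦ lcoeff ℂ j ∘ₗ LinearMap.proj n

theorem quasiModularSubmodule_fg (k p : ℕ) : (quasiModularSubmodule k p).FG := by
  induction p with
  | zero =>
    have : quasiModularSubmodule k 0 = ⊥ := by
      refine (Submodule.eq_bot_iff _).mpr fun a ha ↦ funext fun n ↦ ?_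
      have h := mem_degreeLT.mp (ha.coeff_mem n)
      simpa using h
    rw [this]
    exact Submodule.fg_bot
  | succ p ih =>
    refine Submodule.fg_of_fg_map_of_fg_inf_ker (coeffMap p) ?_ ?_
    · have : IsNoetherian ℂ (LinearMap.range (qExpansionCoeffs ((k : ℤ) - 2 * p))) :=
        inferInstance
      have hle : (quasiModularSubmodule k (p + 1)).map (coeffMap p) ≤
          LinearMap.range (qExpansionCoeffs ((k : ℤ) - 2 * p)) := by
        rintro _ ⟨a, ha, rfl⟩
        have ha : IsQuasiModular k (p + 1) a := ha
        exact ⟨ha.leadingForm, funext fun n ↦ ha.coeff_leadingForm n⟩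
      exact (isNoetherian_submodule.mp this) _ hle
    · have : IsNoetherian ℂ (quasiModularSubmodule k p) := by
        have := Module.Finite.iff_fg.mpr ih
        infer_instance
      refine (isNoetherian_submodule.mp this) _ fun a ha ↦ ?_
      obtain ⟨ha, hker⟩ := ha
      have ha : IsQuasiModular k (p + 1) a := ha
      refine ⟨fun n ↦ ?_, ha.summable, ha.transforms⟩
      have h0 : (a n).coeff p = 0 := congrFun hker n
      rw [mem_degreeLT, degree_lt_iff_coeff_zero]
      intro m hm
      rcases hm.eq_or_lt with rfl | hm
      · exact h0
      · exact (degree_lt_iff_coeff_zero _ _).mp (mem_degreeLT.mp (ha.coeff_mem n)) m hm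

lemma TransformsUnder.apply {F : ℂ → ℂ → ℂ} {k : ℕ} {γ : SL(2, ℤ)} (h : TransformsUnder F k γ)
    (τ : ℍ) (X : ℂ) :
    F ((γ 0 0 * τ + γ 0 1) / (γ 1 0 * τ + γ 1 1))
      ((γ 1 0 * τ + γ 1 1) ^ 2 * X + γ 1 0 * (γ 1 0 * τ + γ 1 1)) =
      (γ 1 0 * τ + γ 1 1) ^ k * F τ X := by
  have h := h τ X
  rw [specialLinearGroup_apply] at h
  simpa [ModularGroup.denom_apply] using h

/-- The Hecke operator of prime index `ℓ` and weight `k` on `q`-series with polynomial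
coefficients. -/
noncomputable def hecke (ℓ k : ℕ) (a : ℕ → ℂ[X]) (n : ℕ) : ℂ[X] :=
  (a (ℓ * n)).comp (C (ℓ : ℂ) * X) +
    if ℓ ∣ n then C ((ℓ : ℂ) ^ (k - 1)) * (a (n / ℓ)).comp (C (ℓ : ℂ)⁻¹ * X) else 0

lemma comp_C_mul_X_mem_degreeLT {p : ℕ} {f : ℂ[X]} (hf : f ∈ degreeLT ℂ p) (c : ℂ) :
    f.comp (C c * X) ∈ degreeLT ℂ p := by
  rw [mem_degreeLT, degree_lt_iff_coeff_zero] at *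
  intro m hm
  rw [comp_C_mul_X_coeff, hf m hm, zero_mul]

section

variable {ℓ : ℕ}

lemma hasSum_dvd (hℓ : 0 < ℓ) {f : ℕ → ℂ} {s : ℂ} (hf : HasSum (fun n ↦ f (ℓ * n)) s) :
    HasSum (fun n ↦ if ℓ ∣ n then f n else 0) s := by
  have hinj : Function.Injective (fun n : ℕ ↦ ℓ * n) := fun x y h ↦ Nat.eq_of_mul_eq_mul_left hℓ h
  refine (hinj.hasSum_iff ?_).mp ?_
  · intro n hn
    rw [if_neg]
    rintro ⟨m, rfl⟩
    exact hn ⟨m, rfl⟩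
  · simpa [Function.comp_def] using hf

lemma nome_div_pow (hℓ : 0 < ℓ) (z : ℂ) (n : ℕ) : nome (z / ℓ) ^ (ℓ * n) = nome z ^ n := by
  have : (ℓ : ℂ) ≠ 0 := by exact_mod_cast hℓ.ne'
  rw [pow_mul, ← nome_natCast_mul, mul_div_cancel₀ _ this]

lemma sum_zmod_val [NeZero ℓ] (f : ℕ → ℂ) : ∑ b : ZMod ℓ, f b.val = ∑ i ∈ range ℓ, f i :=
  Finset.sum_nbij' ZMod.val (fun i ↦ (i : ZMod ℓ)) (fun b _ ↦ mem_range.mpr b.val_lt)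
    (by simp) (by simp) (fun i hi ↦ ZMod.val_cast_of_lt (mem_range.mp hi)) (by simp)

lemma sum_nome_add_div_pow [Fact ℓ.Prime] (z : ℂ) (n : ℕ) :
    ∑ b : ZMod ℓ, nome ((z + b.val) / ℓ) ^ n = if ℓ ∣ n then ℓ * nome (z / ℓ) ^ n else 0 := by
  have hℓ : ℓ.Prime := Fact.out
  have hζ := isPrimitiveRoot_exp ℓ hℓ.ne_zero
  set ζ := cexp (2 * π * Complex.I / ℓ)
  have hterm : ∀ i : ℕ, nome ((z + i) / ℓ) ^ n = nome (z / ℓ) ^ n * (ζ ^ n) ^ i := by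
    intro i
    have : nome ((z + i) / ℓ) = nome (z / ℓ) * ζ ^ i := by
      rw [nome, nome, ← Complex.exp_nat_mul, ← Complex.exp_add]
      congr 1
      ring
    rw [this, mul_pow]
    ring
  rw [sum_zmod_val (fun i ↦ nome ((z + i) / ℓ) ^ n), Finset.sum_congr rfl fun i _ ↦ hterm i,
    ← Finset.mul_sum]
  split_ifs with h
  · simp [(hζ.pow_eq_one_iff_dvd n).mpr h, mul_comm]
  · rw [(hζ.pow_of_coprime n ((hℓ.coprime_iff_not_dvd.mpr h).symm)).geom_sum_eq_zero hℓ.one_lt,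
      mul_zero]

variable {k p : ℕ} {a : ℕ → ℂ[X]}

/-- `τ ↦ (τ + b) / ℓ` on the upper half plane. -/
noncomputable def shiftDiv [NeZero ℓ] (τ : ℍ) (b : ℕ) : ℍ :=
  ⟨(τ + b) / ℓ, by
    have h : (0 : ℝ) < ℓ := by exact_mod_cast NeZero.pos ℓ
    rw [Complex.div_natCast_im]
    simpa using div_pos τ.im_pos h⟩

/-- `τ ↦ ℓ τ` on the upper half plane. -/
noncomputable def natMul [NeZero ℓ] (τ : ℍ) : ℍ :=
  ⟨ℓ * τ, by
    have h : (0 : ℝ) < ℓ := by exact_mod_cast NeZero.pos ℓ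
    simpa using mul_pos h τ.im_pos⟩

lemma hecke_term [NeZero ℓ] (τ : ℍ) (X : ℂ) (n : ℕ) :
    (hecke ℓ k a n).eval X * nome τ ^ n =
      (a (ℓ * n)).eval (ℓ * X) * nome (shiftDiv (ℓ := ℓ) τ 0 : ℍ) ^ (ℓ * n) +
      if ℓ ∣ n then (ℓ : ℂ) ^ (k - 1) * ((a (n / ℓ)).eval (X / ℓ) *
        nome (natMul (ℓ := ℓ) τ : ℍ) ^ (n / ℓ)) else 0 := by
  have h1 : nome (shiftDiv (ℓ := ℓ) τ 0 : ℍ) ^ (ℓ * n) = nome τ ^ n := by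
    simp only [shiftDiv, Nat.cast_zero, add_zero]
    exact nome_div_pow (NeZero.pos ℓ) _ _
  rw [h1, hecke, eval_add, add_mul, eval_comp, eval_mul, eval_C, eval_X]
  congr 1
  split_ifs with h
  · obtain ⟨m, rfl⟩ := h
    rw [Nat.mul_div_cancel_left m (NeZero.pos ℓ)]
    simp only [natMul, nome_natCast_mul, ← pow_mul]
    simp
    ring_nf
  · simp

lemma IsQuasiModular.hasSum_hecke [Fact ℓ.Prime] (ha : IsQuasiModular k p a) (τ : ℍ) (X : ℂ) :
    HasSum (fun n ↦ (hecke ℓ k a n).eval X * nome τ ^ n)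
      ((ℓ : ℂ)⁻¹ * ∑ b : ZMod ℓ, evalSeries a ((τ + b.val) / ℓ) (ℓ * X) +
        (ℓ : ℂ) ^ (k - 1) * evalSeries a (ℓ * τ) (X / ℓ)) := by
  have hℓ : ℓ.Prime := Fact.out
  have hℓ0 : (ℓ : ℂ) ≠ 0 := by exact_mod_cast hℓ.ne_zero
  have hsum : ∀ b : ZMod ℓ, HasSum (fun n ↦ (a n).eval (ℓ * X) * nome ((τ + b.val) / ℓ) ^ n)
      (evalSeries a ((τ + b.val) / ℓ) (ℓ * X)) :=
    fun b ↦ ((ha.summable (shiftDiv (ℓ := ℓ) τ b.val) _).of_norm).hasSum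
  simp only [hecke_term]
  refine HasSum.add ?_ ?_
  · have h := (hasSum_sum (s := univ) fun b _ ↦ hsum b).mul_left (ℓ : ℂ)⁻¹
    have hinj : Function.Injective (fun n : ℕ ↦ ℓ * n) :=
      fun x y h ↦ Nat.eq_of_mul_eq_mul_left hℓ.pos h
    have hterm : ∀ n, (ℓ : ℂ)⁻¹ * ∑ b : ZMod ℓ, (a n).eval (ℓ * X) * nome ((τ + b.val) / ℓ) ^ n =
        if ℓ ∣ n then (a n).eval (ℓ * X) * nome (shiftDiv (ℓ := ℓ) τ 0 : ℍ) ^ n else 0 := by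
      intro n
      rw [← Finset.mul_sum, sum_nome_add_div_pow]
      split_ifs
      · simp only [shiftDiv, Nat.cast_zero, add_zero]
        field_simp
      · simp
    simp only [hterm] at h
    rw [← hinj.hasSum_iff] at h
    · simpa [Function.comp_def] using h
    · intro n hn
      rw [if_neg]
      rintro ⟨m, rfl⟩
      exact hn ⟨m, rfl⟩
  · refine hasSum_dvd hℓ.pos (f := fun n ↦ (ℓ : ℂ) ^ (k - 1) * ((a (n / ℓ)).eval (X / ℓ) *
        nome (natMul (ℓ := ℓ) τ : ℍ) ^ (n / ℓ))) ?_
    simp only [Nat.mul_div_cancel_left _ hℓ.pos]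
    exact (((ha.summable (natMul (ℓ := ℓ) τ) _).of_norm).hasSum).mul_left _

lemma IsQuasiModular.evalSeries_hecke [Fact ℓ.Prime] (ha : IsQuasiModular k p a) (τ : ℍ) (X : ℂ) :
    evalSeries (hecke ℓ k a) τ X =
      (ℓ : ℂ)⁻¹ * ∑ b : ZMod ℓ, evalSeries a ((τ + b.val) / ℓ) (ℓ * X) +
        (ℓ : ℂ) ^ (k - 1) * evalSeries a (ℓ * τ) (X / ℓ) :=
  (ha.hasSum_hecke τ X).tsum_eq

lemma IsQuasiModular.evalSeries_shift [Fact ℓ.Prime] (ha : IsQuasiModular k p a) (τ : ℍ) (X : ℂ)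
    {b c : ZMod ℓ} (hbc : b * c = -1) :
    evalSeries a ((-1 / τ + b.val) / ℓ) (ℓ * (τ ^ 2 * X + τ)) =
      τ ^ k * evalSeries a ((τ + c.val) / ℓ) (ℓ * X) := by
  have hℓ : ℓ.Prime := Fact.out
  have hℓ0 : (ℓ : ℂ) ≠ 0 := by exact_mod_cast hℓ.ne_zero
  have hdvd : ℓ ∣ b.val * c.val + 1 := by
    rw [← ZMod.natCast_eq_zero_iff]
    simp [hbc]
  obtain ⟨d, hd⟩ := hdvd
  have hd' : (b.val * c.val + 1 : ℤ) = ℓ * d := by exact_mod_cast hd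
  let γ : SL(2, ℤ) := ⟨!![(b.val : ℤ), -(d : ℤ); (ℓ : ℤ), -(c.val : ℤ)], by
    rw [Matrix.det_fin_two_of]
    linarith⟩
  have h00 : γ 0 0 = b.val := rfl
  have h01 : γ 0 1 = -(d : ℤ) := rfl
  have h10 : γ 1 0 = ℓ := rfl
  have h11 : γ 1 1 = -(c.val : ℤ) := rfl
  have hd'' : (b.val * c.val + 1 : ℂ) = ℓ * d := by exact_mod_cast hd
  have h := (ha.transforms γ).apply (shiftDiv (ℓ := ℓ) τ c.val) (ℓ * X)
  rw [h00, h01, h10, h11] at h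
  have hτ : (τ : ℂ) ≠ 0 := τ.ne_zero
  have hden : ((ℓ : ℤ) : ℂ) * (shiftDiv (ℓ := ℓ) τ c.val : ℍ) + (-(c.val : ℤ) : ℤ) = τ := by
    simp only [shiftDiv]
    push_cast
    field_simp
    ring
  have hnum : (((b.val : ℤ) : ℂ) * (shiftDiv (ℓ := ℓ) τ c.val : ℍ) + (-(d : ℤ) : ℤ)) / τ =
      (-1 / τ + b.val) / ℓ := by
    simp only [shiftDiv]
    push_cast
    field_simp
    linear_combination hd''
  rw [hden, hnum] at h
  have he : (ℓ * (τ ^ 2 * X + τ) : ℂ) = τ ^ 2 * (ℓ * X) + ((ℓ : ℤ) : ℂ) * τ := by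
    push_cast
    ring
  rw [he]
  exact h

lemma IsQuasiModular.hecke [Fact ℓ.Prime] (hk : 1 ≤ k) (ha : IsQuasiModular k p a) :
    IsQuasiModular k p (hecke ℓ k a) := by
  have hℓ : ℓ.Prime := Fact.out
  have hℓ0 : (ℓ : ℂ) ≠ 0 := by exact_mod_cast hℓ.ne_zero
  refine ⟨fun n ↦ ?_, fun τ X ↦ (ha.hasSum_hecke τ X).summable.norm, ?_⟩
  · refine Submodule.add_mem _ (comp_C_mul_X_mem_degreeLT (ha.coeff_mem _) _) ?_
    split_ifs
    · rw [← smul_eq_C_mul]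
      exact Submodule.smul_mem _ _ (comp_C_mul_X_mem_degreeLT (ha.coeff_mem _) _)
    · exact Submodule.zero_mem _
  · refine transformsUnder_of_S_T (transformsUnder_S_iff.mpr fun τ X ↦ ?_)
      (transformsUnder_T_iff.mpr fun τ X ↦ evalSeries_add_one _ _ _)
    have hτ : (τ : ℂ) ≠ 0 := τ.ne_zero
    obtain ⟨k, rfl⟩ : ∃ l, k = l + 1 := ⟨k - 1, by omega⟩
    have hS := transformsUnder_S_iff.mp (ha.transforms ModularGroup.S)
    have h := ha.evalSeries_hecke (ℓ := ℓ) (ModularGroup.S • τ) (τ ^ 2 * X + τ)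
    have hSτ : ((ModularGroup.S • τ : ℍ) : ℂ) = -1 / τ := by
      rw [UpperHalfPlane.modular_S_smul]
      simp [neg_div, ← inv_neg]
    rw [hSτ] at h
    rw [h, ha.evalSeries_hecke]
    have h1 := hS (shiftDiv (ℓ := ℓ) τ 0) (ℓ * X)
    have h2 := hS (natMul (ℓ := ℓ) τ) (X / ℓ)
    simp only [shiftDiv, natMul, Nat.cast_zero, add_zero] at h1 h2
    rw [← Finset.add_sum_erase _ _ (Finset.mem_univ (0 : ZMod ℓ)),
      ← Finset.add_sum_erase _ _ (Finset.mem_univ (0 : ZMod ℓ))]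
    have h3 : ∑ b ∈ univ.erase (0 : ZMod ℓ),
          evalSeries a ((-1 / τ + b.val) / ℓ) (ℓ * (τ ^ 2 * X + τ)) =
        ∑ b ∈ univ.erase (0 : ZMod ℓ), τ ^ (k + 1) * evalSeries a ((τ + b.val) / ℓ) (ℓ * X) := by
      refine Finset.sum_nbij' (fun b ↦ -b⁻¹) (fun b ↦ -b⁻¹) (by simp) (by simp)
        (by simp) (by simp) fun b hb ↦ ha.evalSeries_shift τ X ?_
      have : b ≠ 0 := by simpa using hb
      field_simp
    have e1 : (-1 / τ : ℂ) / ℓ = -1 / (ℓ * τ) := by field_simp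
    have e2 : (ℓ * (τ ^ 2 * X + τ) : ℂ) = (ℓ * τ) ^ 2 * (X / ℓ) + ℓ * τ := by field_simp
    have e3 : (ℓ * (-1 / τ) : ℂ) = -1 / (τ / ℓ) := by field_simp
    have e4 : ((τ ^ 2 * X + τ) / ℓ : ℂ) = (τ / ℓ) ^ 2 * (ℓ * X) + τ / ℓ := by field_simp
    rw [h3, ZMod.val_zero, Nat.cast_zero, add_zero, add_zero, e1, e2, h2, e3, e4, h1,
      ← Finset.mul_sum, Nat.add_sub_cancel, div_pow]
    generalize evalSeries a (τ / ℓ) (ℓ * X) = A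
    generalize evalSeries a (ℓ * τ) (X / ℓ) = B
    field_simp
    ring

end

open scoped ArithmeticFunction.sigma

/-- The `q`-expansion coefficients of the normalised Eisenstein series of even weight `k ≥ 2`. -/
noncomputable def eisensteinCoeff (k n : ℕ) : ℚ :=
  if n = 0 then 1 else -(2 * k / _root_.bernoulli k) * σ (k - 1) n

lemma isQuasiModular_of_hasSum {k : ℕ} {f : ℍ → ℂ} {c : ℕ → ℂ} {β : ℂ}
    (hf : ∀ τ : ℍ, HasSum (fun n ↦ c n * nome τ ^ n) (f τ))
    (htrans : ∀ (γ : SL(2, ℤ)) (τ : ℍ), f (γ • τ) =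
      denom γ τ ^ k * f τ - β * γ 1 0 * denom γ τ)
    (hβ : β ≠ 0 → k = 2) :
    IsQuasiModular k 2 (fun n ↦ C (c n) + if n = 0 then C β * X else 0) := by
  have hval : ∀ (τ : ℍ) (x : ℂ), HasSum (fun n ↦ (C (c n) + if n = 0 then C β * X else 0).eval x *
      nome τ ^ n) (f τ + β * x) := by
    intro τ x
    convert! (hf τ).add (hasSum_ite_eq (0 : ℕ) (β * x)) using 2 with n
    by_cases h : n = 0 <;> simp [h]
  have hseries := fun (τ : ℍ) (x : ℂ) ↦ (hval τ x).tsum_eq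
  refine ⟨fun n ↦ ?_, fun τ x ↦ (hval τ x).summable.norm, fun γ τ x ↦ ?_⟩
  · rw [mem_degreeLT]
    have h : ((C (c n) + if n = 0 then C β * X else 0) : ℂ[X]) =
        C (if n = 0 then β else 0) * X + C (c n) := by
      split_ifs <;> simp [add_comm]
    rw [h]
    exact degree_linear_le.trans_lt (by norm_num)
  · rw [evalSeries, evalSeries, hseries, hseries, htrans]
    by_cases h : β = 0
    · simp [h]
    · rw [hβ h]
      ring

lemma exists_isQuasiModular_eisenstein {k : ℕ} (hk : 2 ≤ k) (hk2 : Even k) :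
    ∃ a, IsQuasiModular k 2 a ∧ ∀ n, (a n).coeff 0 = (eisensteinCoeff k n : ℚ) := by
  rcases hk.eq_or_lt with rfl | hk
  · refine ⟨_, isQuasiModular_of_hasSum (f := EisensteinSeries.E2)
      (c := fun n ↦ (eisensteinCoeff 2 n : ℚ)) (β := 6 * Complex.I / π) (fun τ ↦ ?_)
      (fun γ τ ↦ ?_) (fun _ ↦ rfl), fun n ↦ ?_⟩
    · have hc : ∀ n, ((eisensteinCoeff 2 n : ℚ) : ℂ) =
          if n = 0 then 1 else -24 * (σ 1 n : ℂ) := by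
        intro n
        rw [eisensteinCoeff, bernoulli_two]
        split_ifs <;> norm_num
      simp_rw [hc]
      exact EisensteinSeries.hasSum_qExpansion_E2 (z := τ)
    · have h := congrFun (EisensteinSeries.E2_slash_action γ) τ
      have h0 : denom γ τ ≠ 0 := denom_ne_zero γ τ
      rw [ModularForm.SL_slash_apply] at h
      simp only [Pi.sub_apply, Pi.smul_apply, EisensteinSeries.D2, riemannZeta_two,
        smul_eq_mul] at h
      have hπ : (π : ℂ) ≠ 0 := by exact_mod_cast Real.pi_ne_zero
      rw [zpow_neg, ← div_eq_mul_inv, div_eq_iff (by simp [h0])] at h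
      rw [h]
      field_simp
    · by_cases h : n = 0 <;> simp [h]
  · refine ⟨_, isQuasiModular_of_hasSum (f := ModularForm.E hk)
      (c := fun n ↦ (eisensteinCoeff k n : ℚ)) (β := 0) (fun τ ↦ ?_)
      (fun γ τ ↦ ?_) (fun h ↦ absurd rfl h), fun n ↦ ?_⟩
    · have h := ModularForm.hasSum_qExpansion (ModularForm.E hk) one_pos
        one_mem_strictPeriods_SL τ
      simp_rw [EisensteinSeries.E_qExpansion_coeff (by omega : 3 ≤ k) hk2, ← nome_eq_qParam] at h
      convert! h using 3 with n
      rw [eisensteinCoeff]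
      split_ifs <;> simp
    · rw [zero_mul, zero_mul, sub_zero]
      exact_mod_cast SlashInvariantForm.slash_action_eqn'' (ModularForm.E hk)
        (γ := (γ : GL (Fin 2) ℝ)) (MonoidHom.mem_range.mpr ⟨γ, rfl⟩ : _ ∈ 𝒮ℒ) τ
    · by_cases h : n = 0 <;> simp [h]

end QuasiModular

section HeckeSequences

variable {R : Type*} [CommRing R]

/-- The Hecke operator on sequences, with multiplier `c` in place of `ℓ ^ (k - 1)`. -/
def heckeSeq (ℓ : ℕ) (c : R) (f : ℕ → R) (n : ℕ) : R :=
  f (ℓ * n) + if ℓ ∣ n then c * f (n / ℓ) else 0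

/-- The sequences obtained from `f` by the Hecke operators of index a power of `ℓ`. -/
def heckePowSeq (ℓ : ℕ) (c : R) (f : ℕ → R) : ℕ → ℕ → R
  | 0, n => f n
  | j + 1, n => f (ℓ ^ (j + 1) * n) + if ℓ ∣ n then c * heckePowSeq ℓ c f j (n / ℓ) else 0

lemma heckeSeq_heckePowSeq_zero (ℓ : ℕ) (c : R) (f : ℕ → R) :
    heckeSeq ℓ c (heckePowSeq ℓ c f 0) = heckePowSeq ℓ c f 1 := by
  funext n
  simp [heckeSeq, heckePowSeq]

lemma heckeSeq_heckePowSeq_succ {ℓ : ℕ} (hℓ : 0 < ℓ) (c : R) (f : ℕ → R) (j : ℕ) :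
    heckeSeq ℓ c (heckePowSeq ℓ c f (j + 1)) =
      heckePowSeq ℓ c f (j + 2) + c • heckePowSeq ℓ c f j := by
  funext n
  simp only [heckeSeq, heckePowSeq, Pi.add_apply, Pi.smul_apply, smul_eq_mul, dvd_mul_right,
    if_true, Nat.mul_div_cancel_left n hℓ]
  rw [← mul_assoc, ← pow_succ]
  ring

lemma heckePowSeq_of_not_dvd {ℓ n : ℕ} (hn : ¬ ℓ ∣ n) (c : R) (f : ℕ → R) (j : ℕ) :
    heckePowSeq ℓ c f j n = f (ℓ ^ j * n) := by
  cases j <;> simp [heckePowSeq, hn]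

lemma exists_period_of_finite {ℓ : ℕ} (hℓ : 0 < ℓ) {c : R} (hc : IsUnit c)
    (F : Submodule R (ℕ → R)) [Finite F] (hF : ∀ f ∈ F, heckeSeq ℓ c f ∈ F) {f : ℕ → R}
    (hf : f ∈ F) :
    ∃ N, 0 < N ∧ ∀ j, 0 < j → ∀ n, ¬ ℓ ∣ n → f (ℓ ^ (j * N - 1) * n) = 0 := by
  let s : F × F → F × F := fun x ↦ (x.2, ⟨heckeSeq ℓ c x.2, hF _ x.2.2⟩ - c • x.1)
  have hs : Function.Injective s := by
    rintro ⟨x, y⟩ ⟨x', y'⟩ h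
    have h1 : y = y' := congrArg Prod.fst h
    have h2 := congrArg Prod.snd h
    subst h1
    simp only [s, sub_right_inj] at h2
    rw [hc.smul_left_cancel.mp h2]
  have hiter : ∀ j, (((s^[j] (0, ⟨f, hf⟩)).2 : F) : ℕ → R) = heckePowSeq ℓ c f j ∧
      (((s^[j + 1] (0, ⟨f, hf⟩)).1 : F) : ℕ → R) = heckePowSeq ℓ c f j ∧
      (((s^[j + 1] (0, ⟨f, hf⟩)).2 : F) : ℕ → R) = heckePowSeq ℓ c f (j + 1) := by
    intro j
    induction j with
    | zero =>
      refine ⟨rfl, rfl, ?_⟩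
      rw [← heckeSeq_heckePowSeq_zero]
      simp [s]
      rfl
    | succ j ih =>
      refine ⟨ih.2.2, ?_, ?_⟩
      · rw [Function.iterate_succ_apply']
        exact ih.2.2
      · rw [Function.iterate_succ_apply']
        have h := heckeSeq_heckePowSeq_succ hℓ c f j
        rw [← ih.2.2, ← ih.2.1] at h
        change heckeSeq ℓ c ((s^[j + 1] (0, ⟨f, hf⟩)).2 : F) -
          c • (((s^[j + 1] (0, ⟨f, hf⟩)).1 : F) : ℕ → R) = _
        rw [h, add_sub_cancel_right]
  obtain ⟨N, hN, hper⟩ := hs.mem_periodicPts (0, ⟨f, hf⟩)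
  refine ⟨N, hN, fun j hj n hn ↦ ?_⟩
  have h := hper.const_mul j
  obtain ⟨i, hi⟩ : ∃ i, j * N = i + 1 := ⟨j * N - 1, by have := Nat.mul_pos hj hN; omega⟩
  rw [hi] at h ⊢
  have h0 := (hiter i).2.1
  rw [h] at h0
  rw [Nat.add_sub_cancel, ← heckePowSeq_of_not_dvd hn c f i, ← h0]
  rfl

end HeckeSequences

lemma exists_forall_lt_eq_zero_imp {K : Type*} [Field K] (V : Submodule K (ℕ → K))
    (hV : V.FG) : ∃ B : ℕ, ∀ v ∈ V, (∀ i < B, v i = 0) → v = 0 := by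
  have : Module.Finite K V := Module.Finite.iff_fg.mpr hV
  let W : ℕ →o (Submodule K V)ᵒᵈ :=
    { toFun := fun B ↦ OrderDual.toDual
        (⨅ i : Fin B, LinearMap.ker (LinearMap.proj (i : ℕ) ∘ₗ V.subtype))
      monotone' := fun B C hBC ↦ OrderDual.toDual_le_toDual.mpr
        (le_iInf fun i ↦ iInf_le_of_le (Fin.castLE hBC i) le_rfl) }
  obtain ⟨B, hB⟩ := IsArtinian.monotone_stabilizes W
  have hmem : ∀ (C : ℕ) (v : V), v ∈ OrderDual.ofDual (W C) ↔ ∀ i < C, (v : ℕ → K) i = 0 := by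
    intro C v
    simp [W, Submodule.mem_iInf, Fin.forall_iff]
  refine ⟨B, fun v hv h0 ↦ funext fun n ↦ ?_⟩
  have h1 := (hmem B ⟨v, hv⟩).mpr h0
  rcases le_total (n + 1) B with h | h
  · exact h0 n h
  · rw [hB _ h] at h1
    exact (hmem _ _).mp h1 n (Nat.lt_succ_self n)

/-- The integral sequences in a space of sequences. -/
def integralSequences {K : Type*} [Field K] (V : Submodule K (ℕ → K)) :
    Submodule ℤ (ℕ → ℤ) where
  carrier := {f | (fun n ↦ (f n : K)) ∈ V}
  zero_mem' := by
    change (fun _ ↦ _) ∈ V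
    convert V.zero_mem using 1
    funext n
    simp
  add_mem' {f g} hf hg := by
    change (fun _ ↦ _) ∈ V
    convert V.add_mem hf hg using 1
    funext n
    simp
  smul_mem' c f hf := by
    change (fun _ ↦ _) ∈ V
    convert V.smul_mem (c : K) hf using 1
    funext n
    simp

lemma integralSequences_fg {K : Type*} [Field K] [CharZero K] (V : Submodule K (ℕ → K))
    (hV : V.FG) : (integralSequences V).FG := by
  obtain ⟨B, hB⟩ := exists_forall_lt_eq_zero_imp V hV
  let φ : integralSequences V →ₗ[ℤ] (Fin B → ℤ) :=
    LinearMap.pi fun i ↦ LinearMap.proj (i : ℕ) ∘ₗ (integralSequences V).subtype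
  have hφ : Function.Injective φ := by
    rw [← LinearMap.ker_eq_bot, LinearMap.ker_eq_bot']
    intro f hf
    have h := hB _ f.2 fun i hi ↦ by
      have := congrFun hf ⟨i, hi⟩
      exact_mod_cast this
    ext n
    have h1 : ((f : ℕ → ℤ) n : K) = 0 := congrFun h n
    exact_mod_cast h1
  have := isNoetherian_of_injective φ hφ
  exact Module.Finite.iff_fg.mp inferInstance

namespace QuasiModular

open Polynomial

/-- The reduction modulo `m` of integral sequences. -/
def reduction (m : ℕ) : (ℕ → ℤ) →ₛₗ[Int.castRingHom (ZMod m)] (ℕ → ZMod m) where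
  toFun f n := (f n : ZMod m)
  map_add' f g := by
    funext n
    simp
  map_smul' c f := by
    funext n
    simp

lemma hecke_coeff_zero (ℓ k : ℕ) (a : ℕ → ℂ[X]) (n : ℕ) :
    (hecke ℓ k a n).coeff 0 = heckeSeq ℓ ((ℓ : ℂ) ^ (k - 1)) (fun n ↦ (a n).coeff 0) n := by
  unfold hecke heckeSeq
  split_ifs <;>
    simp only [coeff_add, comp_C_mul_X_coeff, coeff_C_mul, pow_zero, mul_one, coeff_zero]

theorem exists_period_of_isQuasiModular {k p : ℕ} (hk : 1 ≤ k) {a : ℕ → ℂ[X]}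
    (ha : IsQuasiModular k p a) {f : ℕ → ℤ} (hf : ∀ n, (a n).coeff 0 = f n) {m ℓ : ℕ}
    (hm : 0 < m) (hℓ : ℓ.Prime) (hℓm : ℓ.Coprime m) :
    ∃ N, 0 < N ∧ ∀ j, 0 < j → ∀ n, ¬ ℓ ∣ n → (m : ℤ) ∣ f (ℓ ^ (j * N - 1) * n) := by
  have : Fact ℓ.Prime := ⟨hℓ⟩
  have : NeZero m := ⟨hm.ne'⟩
  have : RingHomSurjective (Int.castRingHom (ZMod m)) := ⟨ZMod.intCast_surjective⟩
  let V := (quasiModularSubmodule k p).map (coeffMap 0)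
  have hV : (integralSequences V).FG :=
    integralSequences_fg V ((quasiModularSubmodule_fg k p).map _)
  let F := (integralSequences V).map (reduction m)
  have hFfg : F.FG := hV.map _
  have : Module.Finite (ZMod m) F := Module.Finite.iff_fg.mpr hFfg
  have : Finite F := Module.finite_of_finite (ZMod m)
  have hc : IsUnit ((ℓ : ZMod m) ^ (k - 1)) := ((ZMod.isUnit_iff_coprime ℓ m).mpr hℓm).pow _
  have hF : ∀ g ∈ F, heckeSeq ℓ ((ℓ : ZMod m) ^ (k - 1)) g ∈ F := by
    rintro _ ⟨g, ⟨b, hb, hbg⟩, rfl⟩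
    refine ⟨heckeSeq ℓ ((ℓ : ℤ) ^ (k - 1)) g, ⟨_, IsQuasiModular.hecke (ℓ := ℓ) hk hb, ?_⟩, ?_⟩
    · have hb' : ∀ n, (b n).coeff 0 = g n := congrFun hbg
      funext n
      change (hecke ℓ k b n).coeff 0 = _
      rw [hecke_coeff_zero]
      unfold heckeSeq
      split_ifs <;> simp [hb']
    · funext n
      change ((heckeSeq ℓ ((ℓ : ℤ) ^ (k - 1)) g n : ℤ) : ZMod m) = _
      unfold heckeSeq
      split_ifs <;> simp [reduction]
  have hfF : reduction m f ∈ F := ⟨f, ⟨a, ha, funext hf⟩, rfl⟩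
  obtain ⟨N, hN, h⟩ := exists_period_of_finite hℓ.pos hc F hF hfF
  exact ⟨N, hN, fun j hj n hn ↦ (ZMod.intCast_zmod_eq_zero_iff_dvd _ _).mp (h j hj n hn)⟩

/-- Modulo every positive integer, the coefficients of `g` vanish along the progressions
`ℓ ^ (j * N - 1) * n` with `¬ ℓ ∣ n`, for all large primes `ℓ` and some `N` depending on `ℓ`. -/
def HasHeckePeriods (g : PowerSeries ℚ) : Prop :=
  ∀ m : ℕ, 0 < m → ∃ B : ℕ, ∀ ℓ : ℕ, ℓ.Prime → B < ℓ → ∃ N, 0 < N ∧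
    ∀ j, 0 < j → ∀ n, ¬ ℓ ∣ n → ∃ z : ℤ, PowerSeries.coeff (ℓ ^ (j * N - 1) * n) g = m * z

lemma hasHeckePeriods_zero : HasHeckePeriods 0 :=
  fun _ _ ↦ ⟨0, fun _ _ _ ↦ ⟨1, one_pos, fun _ _ _ _ ↦ ⟨0, by simp⟩⟩⟩

lemma hasHeckePeriods_one : HasHeckePeriods 1 := by
  refine fun _ _ ↦ ⟨0, fun ℓ hℓ _ ↦ ⟨1, one_pos, fun _ _ n hn ↦ ⟨0, ?_⟩⟩⟩
  have hn0 : n ≠ 0 := by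
    rintro rfl
    exact hn (dvd_zero ℓ)
  rw [PowerSeries.coeff_one, if_neg (mul_ne_zero (pow_ne_zero _ hℓ.ne_zero) hn0)]
  simp

lemma HasHeckePeriods.add {g h : PowerSeries ℚ} (hg : HasHeckePeriods g)
    (hh : HasHeckePeriods h) : HasHeckePeriods (g + h) := by
  intro m hm
  obtain ⟨B, hB⟩ := hg m hm
  obtain ⟨C, hC⟩ := hh m hm
  refine ⟨max B C, fun ℓ hℓ hlt ↦ ?_⟩
  obtain ⟨N, hN, hgN⟩ := hB ℓ hℓ (lt_of_le_of_lt (le_max_left _ _) hlt)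
  obtain ⟨N', hN', hhN⟩ := hC ℓ hℓ (lt_of_le_of_lt (le_max_right _ _) hlt)
  refine ⟨N * N', Nat.mul_pos hN hN', fun j hj n hn ↦ ?_⟩
  obtain ⟨z, hz⟩ := hgN (j * N') (Nat.mul_pos hj hN') n hn
  obtain ⟨w, hw⟩ := hhN (j * N) (Nat.mul_pos hj hN) n hn
  refine ⟨z + w, ?_⟩
  rw [map_add, show j * (N * N') = j * N' * N by ring, hz,
    show j * N' * N = j * N * N' by ring, hw]
  push_cast
  ring

lemma HasHeckePeriods.smul {g : PowerSeries ℚ} (hg : HasHeckePeriods g) (q : ℚ) :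
    HasHeckePeriods (q • g) := by
  intro m hm
  obtain ⟨B, hB⟩ := hg (m * q.den) (Nat.mul_pos hm q.den_pos)
  refine ⟨B, fun ℓ hℓ hlt ↦ ?_⟩
  obtain ⟨N, hN, h⟩ := hB ℓ hℓ hlt
  refine ⟨N, hN, fun j hj n hn ↦ ?_⟩
  obtain ⟨z, hz⟩ := h j hj n hn
  refine ⟨q.num * z, ?_⟩
  rw [map_smul, hz, smul_eq_mul]
  push_cast
  rw [← Rat.mul_den_eq_num q]
  ring

/-- A positive multiple of `g` has integral coefficients, which are the constant coefficients
of a quasimodular form of positive weight. -/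
def IsQuasiModularSeries (g : PowerSeries ℚ) : Prop :=
  ∃ (k p : ℕ) (a : ℕ → ℂ[X]) (D : ℕ) (f : ℕ → ℤ), 1 ≤ k ∧ 0 < D ∧ IsQuasiModular k p a ∧
    (∀ n, (a n).coeff 0 = f n) ∧ ∀ n, (f n : ℚ) = D * PowerSeries.coeff n g

lemma IsQuasiModularSeries.hasHeckePeriods {g : PowerSeries ℚ} (hg : IsQuasiModularSeries g) :
    HasHeckePeriods g := by
  obtain ⟨k, p, a, D, f, hk, hD, ha, haf, hfg⟩ := hg
  intro m hm
  have hmD := Nat.mul_pos hm hD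
  refine ⟨m * D, fun ℓ hℓ hlt ↦ ?_⟩
  obtain ⟨N, hN, h⟩ := exists_period_of_isQuasiModular hk ha haf hmD hℓ
    (Nat.coprime_of_lt_prime hmD.ne' hlt hℓ)
  refine ⟨N, hN, fun j hj n hn ↦ ?_⟩
  obtain ⟨z, hz⟩ := h j hj n hn
  refine ⟨z, ?_⟩
  have h1 := hfg (ℓ ^ (j * N - 1) * n)
  rw [hz] at h1
  have hD' : (D : ℚ) ≠ 0 := by exact_mod_cast hD.ne'
  apply mul_left_cancel₀ hD'
  rw [← h1]
  push_cast
  ring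

lemma IsQuasiModularSeries.mul {g h : PowerSeries ℚ} (hg : IsQuasiModularSeries g)
    (hh : IsQuasiModularSeries h) : IsQuasiModularSeries (g * h) := by
  obtain ⟨k, p, a, D, f, hk, hD, ha, haf, hfg⟩ := hg
  obtain ⟨k', p', a', D', f', hk', hD', ha', haf', hfg'⟩ := hh
  refine ⟨k + k', p + p', _, D * D', fun n ↦ ∑ x ∈ antidiagonal n, f x.1 * f' x.2, by omega,
    Nat.mul_pos hD hD', ha.mul ha', fun n ↦ ?_, fun n ↦ ?_⟩
  · rw [finsetSum_coeff]
    push_cast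
    exact Finset.sum_congr rfl fun x _ ↦ by rw [mul_coeff_zero, haf, haf']
  · push_cast
    rw [PowerSeries.coeff_mul, Finset.mul_sum]
    refine Finset.sum_congr rfl fun x _ ↦ ?_
    rw [hfg, hfg']
    ring

/-- The Eisenstein series of weight `2 * r`. -/
noncomputable def eisensteinSeries (r : ℕ) : PowerSeries ℚ :=
  PowerSeries.mk (eisensteinCoeff (2 * r))

lemma isQuasiModularSeries_eisensteinSeries {r : ℕ} (hr : 1 ≤ r) :
    IsQuasiModularSeries (eisensteinSeries r) := by
  obtain ⟨a, ha, h⟩ := exists_isQuasiModular_eisenstein (k := 2 * r) (by omega) (even_two_mul r)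
  set q : ℚ := -(2 * (2 * r : ℕ) / _root_.bernoulli (2 * r)) with hq
  have hcoeff : ∀ n, ∃ z : ℤ, (z : ℚ) = q.den * eisensteinCoeff (2 * r) n := by
    intro n
    unfold eisensteinCoeff
    split_ifs
    · exact ⟨q.den, by simp⟩
    · refine ⟨q.num * ArithmeticFunction.sigma (2 * r - 1) n, ?_⟩
      rw [← hq]
      push_cast
      rw [← Rat.mul_den_eq_num q]
      ring
  choose f hf using hcoeff
  refine ⟨2 * r, 2, fun n ↦ (q.den : ℂ) • a n, q.den, f, by omega, q.den_pos,
    (quasiModularSubmodule _ _).smul_mem _ ha, fun n ↦ ?_, fun n ↦ ?_⟩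
  · rw [coeff_smul, h, smul_eq_mul]
    exact_mod_cast (congrArg (fun x : ℚ ↦ (x : ℂ)) (hf n)).symm
  · rw [eisensteinSeries, PowerSeries.coeff_mk]
    exact hf n

/-- The algebra of power series generated by the Eisenstein series. -/
noncomputable def quasiModularAlgebra : Subalgebra ℚ (PowerSeries ℚ) :=
  Algebra.adjoin ℚ {g | ∃ r, 1 ≤ r ∧ g = eisensteinSeries r}

theorem hasHeckePeriods_of_mem {g : PowerSeries ℚ} (hg : g ∈ quasiModularAlgebra) :
    HasHeckePeriods g := by
  rw [quasiModularAlgebra, ← Subalgebra.mem_toSubmodule, Algebra.adjoin_eq_span] at hg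
  induction hg using Submodule.span_induction with
  | mem x hx =>
    have h : x = 1 ∨ IsQuasiModularSeries x := by
      induction hx using Submonoid.closure_induction with
      | mem x hx =>
        obtain ⟨r, hr, rfl⟩ := hx
        exact Or.inr (isQuasiModularSeries_eisensteinSeries hr)
      | one => exact Or.inl rfl
      | mul x y _ _ hx hy =>
        rcases hx with rfl | hx
        · simpa using hy
        · rcases hy with rfl | hy
          · exact Or.inr (by simpa using hx)
          · exact Or.inr (hx.mul hy)
    rcases h with rfl | h
    · exact hasHeckePeriods_one
    · exact h.hasHeckePeriods
  | zero => exact hasHeckePeriods_zero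
  | add x y _ _ hx hy => exact hx.add hy
  | smul q x _ hx => exact hx.smul q

end QuasiModular

section SymmetricSums

variable {A : Type*} [CommRing A]

/-- The elementary symmetric function of degree `a` in `y 0, …, y (K - 1)`. -/
def elementarySum (y : ℕ → A) : ℕ → ℕ → A
  | 0, _ => 1
  | _ + 1, 0 => 0
  | a + 1, K + 1 => elementarySum y (a + 1) K + y K * elementarySum y a K

/-- The complete homogeneous symmetric function of degree `a` in `y 0, …, y (K - 1)`. -/
def completeSum (y : ℕ → A) : ℕ → ℕ → A
  | 0, _ => 1
  | _ + 1, 0 => 0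
  | a + 1, K + 1 => completeSum y (a + 1) K + y K * completeSum y a (K + 1)

/-- The power sum of degree `r` in `y 0, …, y (K - 1)`. -/
def powerSum (y : ℕ → A) (r K : ℕ) : A :=
  ∑ k ∈ range K, y k ^ r

lemma map_elementarySum {A' : Type*} [CommRing A'] (φ : A →+* A') (y : ℕ → A) (a K : ℕ) :
    φ (elementarySum y a K) = elementarySum (φ ∘ y) a K := by
  induction K generalizing a with
  | zero => cases a <;> simp [elementarySum]
  | succ K ih => cases a <;> simp [elementarySum, ih]

lemma map_completeSum {A' : Type*} [CommRing A'] (φ : A →+* A') (y : ℕ → A) (a K : ℕ) :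
    φ (completeSum y a K) = completeSum (φ ∘ y) a K := by
  induction K generalizing a with
  | zero => cases a <;> simp [completeSum]
  | succ K ih =>
    induction a with
    | zero => simp [completeSum]
    | succ a iha => simp [completeSum, ih, iha]

/-- A sum over tuples in `range (K + 1)` satisfying `T`, split according to whether the last
entry is `K`. -/
lemma sum_prod_filter_piFinset_succ (y : ℕ → A) {a K L : ℕ} {T : (Fin (a + 1) → ℕ) → Prop}
    {T' : (Fin a → ℕ) → Prop} [DecidablePred T] [DecidablePred T']
    (hlt : ∀ f, T f → f (Fin.last a) < K → ∀ i, f i < K)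
    (hT : ∀ g, T (Fin.snoc g K : Fin (a + 1) → ℕ) ∧ (∀ i, g i < K + 1) ↔
      T' g ∧ ∀ i, g i < L) :
    ∑ f ∈ (Fintype.piFinset fun _ : Fin (a + 1) ↦ range (K + 1)) with T f, ∏ i, y (f i) =
      ∑ f ∈ (Fintype.piFinset fun _ : Fin (a + 1) ↦ range K) with T f, ∏ i, y (f i) +
        y K * ∑ g ∈ (Fintype.piFinset fun _ : Fin a ↦ range L) with T' g, ∏ i, y (g i) := by
  rw [← Finset.sum_filter_add_sum_filter_not _ (fun f ↦ f (Fin.last a) < K)]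
  congr 1
  · refine Finset.sum_congr (Finset.ext fun f ↦ ?_) fun _ _ ↦ rfl
    simp only [mem_filter, Fintype.mem_piFinset, mem_range]
    exact ⟨fun h ↦ ⟨hlt f h.1.2 h.2, h.1.2⟩,
      fun h ↦ ⟨⟨fun i ↦ (h.1 i).trans (Nat.lt_succ_self K), h.2⟩, h.1 _⟩⟩
  · rw [Finset.mul_sum]
    have hlast : ∀ f ∈ ({f ∈ ({f ∈ (Fintype.piFinset fun _ : Fin (a + 1) ↦ range (K + 1)) | T f})
        | ¬ f (Fin.last a) < K}), f (Fin.last a) = K := by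
      intro f hf
      simp only [mem_filter, Fintype.mem_piFinset, mem_range] at hf
      have := hf.1.1 (Fin.last a)
      omega
    refine Finset.sum_nbij' (fun f ↦ Fin.init f) (fun g ↦ Fin.snoc g K) ?_ ?_ ?_ ?_ ?_
    · intro f hf
      have hK := hlast f hf
      simp only [mem_filter, Fintype.mem_piFinset, mem_range] at hf ⊢
      refine (and_comm.trans (hT _).symm).mpr ⟨?_, fun i ↦ hf.1.1 _⟩
      rw [← hK, Fin.snoc_init_self]
      exact hf.1.2
    · intro g hg
      simp only [mem_filter, Fintype.mem_piFinset, mem_range] at hg ⊢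
      have h := (hT g).mpr hg.symm
      refine ⟨⟨fun i ↦ ?_, h.1⟩, by simp⟩
      refine Fin.lastCases ?_ (fun i ↦ ?_) i
      · simp
      · simpa using h.2 i
    · intro f hf
      have hK := hlast f hf
      rw [← hK, Fin.snoc_init_self]
    · intro g _
      simp
    · intro f hf
      rw [Fin.prod_univ_castSucc, hlast f hf, mul_comm]
      rfl

lemma sum_strictMono_eq_elementarySum (y : ℕ → A) (a K : ℕ) :
    ∑ f ∈ (Fintype.piFinset fun _ : Fin a ↦ range K) with ∀ i j, i < j → f i < f j,
      ∏ i, y (f i) = elementarySum y a K := by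
  induction K generalizing a with
  | zero => cases a <;> simp [elementarySum]
  | succ K ih =>
    cases a with
    | zero => simp [elementarySum]
    | succ a =>
      rw [elementarySum, ← ih, ← ih]
      refine sum_prod_filter_piFinset_succ y (fun f hf hK i ↦ ?_) fun g ↦ ?_
      · rcases (Fin.le_last i).lt_or_eq with h | h
        · exact (hf _ _ h).trans hK
        · rwa [h]
      · simp only [Fin.forall_fin_succ', Fin.snoc_castSucc, Fin.snoc_last, Fin.castSucc_lt_last,
          Fin.castSucc_lt_castSucc_iff, lt_irrefl, forall_const, false_imp_iff,
          not_lt_of_ge (Fin.le_last _)]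
        grind

lemma sum_monotone_eq_completeSum (y : ℕ → A) (a K : ℕ) :
    ∑ f ∈ (Fintype.piFinset fun _ : Fin a ↦ range K) with ∀ i j, i ≤ j → f i ≤ f j,
      ∏ i, y (f i) = completeSum y a K := by
  induction K generalizing a with
  | zero => cases a <;> simp [completeSum]
  | succ K ih =>
    induction a with
    | zero => simp [completeSum]
    | succ a iha =>
      rw [completeSum, ← ih, ← iha]
      refine sum_prod_filter_piFinset_succ y (fun f hf hK i ↦ ?_) fun g ↦ ?_
      · exact (hf _ _ (Fin.le_last i)).trans_lt hK
      · simp only [Fin.forall_fin_succ', Fin.snoc_castSucc, Fin.snoc_last, Fin.le_last,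
          Fin.castSucc_le_castSucc_iff, le_refl, forall_const]
        grind

lemma mk_elementarySum_zero (y : ℕ → A) : PowerSeries.mk (elementarySum y · 0) = 1 := by
  ext a
  cases a <;> simp [elementarySum, PowerSeries.coeff_one]

lemma mk_elementarySum_succ (y : ℕ → A) (K : ℕ) :
    PowerSeries.mk (elementarySum y · (K + 1)) =
      PowerSeries.mk (elementarySum y · K) * (1 + PowerSeries.C (y K) * PowerSeries.X) := by
  ext a
  rw [mul_add, mul_one, mul_left_comm, map_add, PowerSeries.coeff_C_mul]
  cases a with
  | zero => simp [elementarySum]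
  | succ a => simp [elementarySum, PowerSeries.coeff_succ_mul_X]

lemma mk_completeSum_zero (y : ℕ → A) : PowerSeries.mk (completeSum y · 0) = 1 := by
  ext a
  cases a <;> simp [completeSum, PowerSeries.coeff_one]

lemma mk_completeSum_succ (y : ℕ → A) (K : ℕ) :
    PowerSeries.mk (completeSum y · (K + 1)) * (1 - PowerSeries.C (y K) * PowerSeries.X) =
      PowerSeries.mk (completeSum y · K) := by
  ext a
  rw [mul_sub, mul_one, mul_left_comm, map_sub, PowerSeries.coeff_C_mul]
  cases a with
  | zero => simp [completeSum]
  | succ a => simp [completeSum, PowerSeries.coeff_succ_mul_X]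

lemma mk_pow_succ_mul (y : A) :
    PowerSeries.mk (fun i ↦ y ^ (i + 1)) * (1 - PowerSeries.C y * PowerSeries.X) =
      PowerSeries.C y := by
  ext a
  rw [mul_sub, mul_one, mul_left_comm, map_sub, PowerSeries.coeff_C_mul]
  cases a with
  | zero => simp
  | succ a =>
    rw [PowerSeries.coeff_succ_mul_X, PowerSeries.coeff_mk, PowerSeries.coeff_mk,
      PowerSeries.coeff_C, if_neg (Nat.succ_ne_zero a)]
    ring

lemma mk_powerSum_succ (y : ℕ → A) (c : A) (K : ℕ) :
    PowerSeries.mk (fun i ↦ c ^ i * powerSum y (i + 1) (K + 1)) =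
      PowerSeries.mk (fun i ↦ c ^ i * powerSum y (i + 1) K) +
        PowerSeries.mk fun i ↦ c ^ i * y K ^ (i + 1) := by
  ext i
  simp only [PowerSeries.coeff_mk, map_add, powerSum, Finset.sum_range_succ, mul_add]

lemma derivative_mk_elementarySum (y : ℕ → A) (K : ℕ) :
    PowerSeries.derivative A (PowerSeries.mk (elementarySum y · K)) =
      PowerSeries.mk (elementarySum y · K) *
        PowerSeries.mk fun i ↦ (-1) ^ i * powerSum y (i + 1) K := by
  induction K with
  | zero =>
    rw [mk_elementarySum_zero]
    ext i
    simp [powerSum]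
  | succ K ih =>
    have h : PowerSeries.mk (fun i ↦ (-1) ^ i * y K ^ (i + 1)) *
        (1 + PowerSeries.C (y K) * PowerSeries.X) = PowerSeries.C (y K) := by
      have h1 := mk_pow_succ_mul (-y K)
      have h2 : PowerSeries.mk (fun i ↦ (-y K) ^ (i + 1)) =
          -PowerSeries.mk (fun i ↦ (-1) ^ i * y K ^ (i + 1)) := by
        ext i
        rw [map_neg, PowerSeries.coeff_mk, PowerSeries.coeff_mk, neg_pow, pow_succ]
        ring
      rw [h2, map_neg] at h1
      linear_combination -h1
    rw [mk_powerSum_succ, mk_elementarySum_succ, Derivation.leibniz, ih]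
    simp only [map_add, Derivation.leibniz, smul_eq_mul, PowerSeries.derivative_X,
      PowerSeries.derivative_C, Derivation.map_one_eq_zero]
    linear_combination -PowerSeries.mk (elementarySum y · K) * h

lemma derivative_mk_completeSum (y : ℕ → A) (K : ℕ) :
    PowerSeries.derivative A (PowerSeries.mk (completeSum y · K)) =
      PowerSeries.mk (completeSum y · K) *
        PowerSeries.mk fun i ↦ powerSum y (i + 1) K := by
  induction K with
  | zero =>
    rw [mk_completeSum_zero]
    ext i
    simp [powerSum]
  | succ K ih =>
    have h := mk_pow_succ_mul (y K)
    have hP := mk_powerSum_succ y 1 K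
    simp only [one_pow, one_mul] at hP
    have hu : IsUnit (1 - PowerSeries.C (y K) * PowerSeries.X) := by
      simp [PowerSeries.isUnit_iff_constantCoeff]
    rw [← mk_completeSum_succ, Derivation.leibniz] at ih
    simp only [map_sub, Derivation.leibniz, smul_eq_mul, PowerSeries.derivative_X,
      PowerSeries.derivative_C, Derivation.map_one_eq_zero] at ih
    apply hu.mul_right_cancel
    rw [hP]
    linear_combination ih - PowerSeries.mk (completeSum y · (K + 1)) * h

/-- Newton's identity for the elementary symmetric functions. -/
lemma succ_mul_elementarySum (y : ℕ → A) (a K : ℕ) :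
    ((a : A) + 1) * elementarySum y (a + 1) K =
      ∑ x ∈ antidiagonal a, elementarySum y x.1 K * ((-1) ^ x.2 * powerSum y (x.2 + 1) K) := by
  have h := congrArg (PowerSeries.coeff a) (derivative_mk_elementarySum y K)
  simp only [PowerSeries.coeff_derivative, PowerSeries.coeff_mul, PowerSeries.coeff_mk] at h
  rw [← h, mul_comm]

/-- Newton's identity for the complete homogeneous symmetric functions. -/
lemma succ_mul_completeSum (y : ℕ → A) (a K : ℕ) :
    ((a : A) + 1) * completeSum y (a + 1) K =
      ∑ x ∈ antidiagonal a, completeSum y x.1 K * powerSum y (x.2 + 1) K := by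
  have h := congrArg (PowerSeries.coeff a) (derivative_mk_completeSum y K)
  simp only [PowerSeries.coeff_derivative, PowerSeries.coeff_mul, PowerSeries.coeff_mk] at h
  rw [← h, mul_comm]

end SymmetricSums

lemma bernoulli_two_mul_ne_zero {r : ℕ} (hr : 1 ≤ r) : bernoulli (2 * r) ≠ 0 := by
  intro h
  have h1 := hasSum_zeta_nat (k := r) (by omega)
  rw [h, Rat.cast_zero, mul_zero, zero_div] at h1
  have h2 := (hasSum_zero_iff_of_nonneg fun n ↦ by positivity).mp h1
  simpa using congrFun h2 1

/-- The generating function of the sums of `F` over divisors. -/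
noncomputable def divisorSeries (F : ℕ → ℚ) : PowerSeries ℚ :=
  PowerSeries.mk fun n ↦ ∑ d ∈ n.divisors, F d

/-- The series `q ^ k / (1 - q ^ k) ^ 2`, or zero when `k = 0`. -/
noncomputable def macMahonTerm (k : ℕ) : PowerSeries ℚ :=
  PowerSeries.mk fun n ↦ if k ∣ n then ((n / k : ℕ) : ℚ) else 0

lemma macMahonTerm_zero : macMahonTerm 0 = 0 := by
  ext n
  simp [macMahonTerm]

lemma macMahonTerm_eq_expand {k : ℕ} (hk : k ≠ 0) :
    macMahonTerm k = PowerSeries.expand k hk (macMahonTerm 1) := by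
  ext n
  simp [macMahonTerm, PowerSeries.coeff_expand]

lemma macMahonTerm_one :
    macMahonTerm 1 = PowerSeries.X * (PowerSeries.invOneSubPow ℚ 2 : PowerSeries ℚ) := by
  ext n
  rw [PowerSeries.invOneSubPow_val_succ_eq_mk_add_choose]
  cases n with
  | zero => simp [macMahonTerm]
  | succ n => simp [macMahonTerm, PowerSeries.coeff_succ_X_mul, add_comm]

lemma coeff_macMahonTerm_one_pow {r : ℕ} (hr : 1 ≤ r) (n : ℕ) :
    PowerSeries.coeff n (macMahonTerm 1 ^ r) = ((n + r - 1).choose (2 * r - 1) : ℚ) := by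
  have h : PowerSeries.invOneSubPow ℚ 2 ^ r = PowerSeries.invOneSubPow ℚ (2 * r) := by
    rw [PowerSeries.invOneSubPow_eq_inv_one_sub_pow, PowerSeries.invOneSubPow_eq_inv_one_sub_pow,
      pow_mul]
  rw [macMahonTerm_one, mul_pow, ← Units.val_pow_eq_pow_val, h,
    PowerSeries.invOneSubPow_val_eq_mk_sub_one_add_choose_of_pos _ _ (by omega),
    PowerSeries.coeff_X_pow_mul']
  split_ifs with hn
  · rw [PowerSeries.coeff_mk, show 2 * r - 1 + (n - r) = n + r - 1 by omega]
  · rw [Nat.choose_eq_zero_of_lt (by omega), Nat.cast_zero]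

lemma coeff_macMahonTerm_pow {r : ℕ} (hr : 1 ≤ r) (k n : ℕ) :
    PowerSeries.coeff n (macMahonTerm k ^ r) =
      if k ∣ n ∧ k ≠ 0 then ((n / k + r - 1).choose (2 * r - 1) : ℚ) else 0 := by
  rcases eq_or_ne k 0 with rfl | hk
  · simp [macMahonTerm_zero, zero_pow (Nat.one_le_iff_ne_zero.mp hr)]
  · rw [macMahonTerm_eq_expand hk, ← map_pow, PowerSeries.coeff_expand,
      coeff_macMahonTerm_one_pow hr]
    simp [hk]

lemma coeff_powerSum_macMahonTerm {r : ℕ} (hr : 1 ≤ r) {n K : ℕ} (hn : n < K) :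
    PowerSeries.coeff n (powerSum macMahonTerm r K) =
      PowerSeries.coeff n
        (divisorSeries fun s ↦ ((s + r - 1).choose (2 * r - 1) : ℚ)) := by
  rw [powerSum, map_sum, divisorSeries, PowerSeries.coeff_mk]
  simp only [coeff_macMahonTerm_pow hr]
  rcases eq_or_ne n 0 with rfl | hn0
  · rw [Nat.divisors_zero, Finset.sum_empty]
    refine Finset.sum_eq_zero fun k _ ↦ ?_
    rw [Nat.zero_div, Nat.choose_eq_zero_of_lt (by omega), Nat.cast_zero, ite_self]
  · rw [← Nat.sum_div_divisors, ← Finset.sum_filter]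
    refine Finset.sum_congr (Finset.ext fun k ↦ ?_) fun _ _ ↦ rfl
    simp only [mem_filter, mem_range, Nat.mem_divisors]
    refine ⟨fun h ↦ ⟨h.2.1, hn0⟩, fun h ↦ ⟨(Nat.le_of_dvd (by omega) h.1).trans_lt hn, h.1, ?_⟩⟩
    rintro rfl
    exact hn0 (Nat.eq_zero_of_zero_dvd h.1)

open Polynomial in
lemma exists_choose_eq_mul_eval_sq (t : ℕ) :
    ∃ p : ℚ[X], ∀ s : ℕ, ((s + t).choose (2 * t + 1) : ℚ) = s * p.eval ((s : ℚ) ^ 2) := by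
  induction t with
  | zero => exact ⟨1, fun s ↦ by simp⟩
  | succ t ih =>
    obtain ⟨p, hp⟩ := ih
    refine ⟨C ((2 * t + 2 : ℚ) * (2 * t + 3))⁻¹ * ((X - C ((t : ℚ) + 1) ^ 2) * p), fun s ↦ ?_⟩
    have h1 := Nat.add_one_mul_choose_eq (s + t) (2 * t + 2)
    have h2 := Nat.choose_succ_right_eq (s + t) (2 * t + 1)
    have h3 : ((s + t).choose (2 * t + 1) : ℚ) * ((s + t - (2 * t + 1) : ℕ) : ℚ) =
        (s + t).choose (2 * t + 1) * ((s : ℚ) - (t + 1)) := by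
      rcases le_or_gt (2 * t + 1) (s + t) with h | h
      · rw [Nat.cast_sub h]
        push_cast
        ring
      · rw [Nat.choose_eq_zero_of_lt h]
        simp
    have h1' : ((s : ℚ) + t + 1) * (s + t).choose (2 * t + 2) =
        (s + t + 1).choose (2 * t + 3) * (2 * t + 3) := by exact_mod_cast h1
    have h2' : ((s + t).choose (2 * t + 2) : ℚ) * (2 * t + 2) =
        (s + t).choose (2 * t + 1) * ((s + t - (2 * t + 1) : ℕ) : ℚ) := by exact_mod_cast h2
    rw [h3, hp] at h2'
    have hne : ((2 * t + 2 : ℚ) * (2 * t + 3)) ≠ 0 := by positivity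
    rw [show s + (t + 1) = s + t + 1 by ring, show 2 * (t + 1) + 1 = 2 * t + 3 by ring]
    simp only [eval_mul, eval_C, eval_sub, eval_X, eval_pow]
    apply mul_left_cancel₀ hne
    rw [mul_left_comm _ (s : ℚ), mul_inv_cancel_left₀ hne]
    linear_combination (-(2 * t + 2 : ℚ)) * h1' + ((s : ℚ) + t + 1) * h2'

namespace QuasiModular

lemma divisorSeries_pow_mem (i : ℕ) :
    divisorSeries (fun s ↦ (s : ℚ) ^ (2 * i + 1)) ∈ quasiModularAlgebra := by
  have hκ : -(2 * ((2 * (i + 1) : ℕ) : ℚ) / bernoulli (2 * (i + 1))) ≠ 0 := by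
    refine neg_ne_zero.mpr (div_ne_zero (by positivity) ?_)
    exact bernoulli_two_mul_ne_zero (Nat.succ_le_succ (Nat.zero_le i))
  have h : divisorSeries (fun s ↦ (s : ℚ) ^ (2 * i + 1)) =
      (-(2 * ((2 * (i + 1) : ℕ) : ℚ) / bernoulli (2 * (i + 1))))⁻¹ •
        (eisensteinSeries (i + 1) - 1) := by
    ext n
    rw [PowerSeries.coeff_smul, map_sub, eisensteinSeries, divisorSeries, PowerSeries.coeff_mk,
      PowerSeries.coeff_mk, PowerSeries.coeff_one, eisensteinCoeff]
    rcases eq_or_ne n 0 with rfl | hn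
    · simp
    · rw [if_neg hn, if_neg hn, sub_zero, smul_eq_mul, inv_mul_cancel_left₀ hκ,
        ArithmeticFunction.sigma_apply, show 2 * (i + 1) - 1 = 2 * i + 1 by omega]
      push_cast
      rfl
  rw [h]
  refine Subalgebra.smul_mem _ (Subalgebra.sub_mem _
    (Algebra.subset_adjoin ?_) (Subalgebra.one_mem _)) _
  exact ⟨i + 1, Nat.succ_le_succ (Nat.zero_le i), rfl⟩

lemma divisorSeries_choose_mem {r : ℕ} (hr : 1 ≤ r) :
    divisorSeries (fun s ↦ ((s + r - 1).choose (2 * r - 1) : ℚ)) ∈ quasiModularAlgebra := by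
  obtain ⟨t, rfl⟩ := Nat.exists_eq_add_of_le' hr
  obtain ⟨p, hp⟩ := exists_choose_eq_mul_eval_sq t
  have h : divisorSeries (fun s ↦ ((s + (t + 1) - 1).choose (2 * (t + 1) - 1) : ℚ)) =
      ∑ i ∈ range (p.natDegree + 1), p.coeff i • divisorSeries fun s ↦ (s : ℚ) ^ (2 * i + 1) := by
    ext n
    simp only [map_sum, PowerSeries.coeff_smul, divisorSeries, PowerSeries.coeff_mk, smul_eq_mul,
      Finset.mul_sum]
    rw [Finset.sum_comm]
    refine Finset.sum_congr rfl fun s _ ↦ ?_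
    rw [show s + (t + 1) - 1 = s + t by omega, show 2 * (t + 1) - 1 = 2 * t + 1 by omega, hp,
      Polynomial.eval_eq_sum_range, Finset.mul_sum]
    exact Finset.sum_congr rfl fun i _ ↦ by ring
  rw [h]
  exact Subalgebra.sum_mem _ fun i _ ↦ Subalgebra.smul_mem _ (divisorSeries_pow_mem i) _

/-- A sequence of power series whose coefficients of degree below `K` stabilise at the `K`-th
term, with stable coefficients forming an element of the quasimodular algebra. -/
def StabilizesInAlgebra (x : ℕ → PowerSeries ℚ) : Prop :=
  ∃ g ∈ quasiModularAlgebra, ∀ n K, n < K → PowerSeries.coeff n (x K) = PowerSeries.coeff n g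

lemma stabilizesInAlgebra_one : StabilizesInAlgebra fun _ ↦ 1 :=
  ⟨1, Subalgebra.one_mem _, fun _ _ _ ↦ rfl⟩

lemma StabilizesInAlgebra.mul {x y : ℕ → PowerSeries ℚ} (hx : StabilizesInAlgebra x)
    (hy : StabilizesInAlgebra y) : StabilizesInAlgebra fun K ↦ x K * y K := by
  obtain ⟨g, hg, hxg⟩ := hx
  obtain ⟨h, hh, hyh⟩ := hy
  refine ⟨g * h, Subalgebra.mul_mem _ hg hh, fun n K hn ↦ ?_⟩
  rw [PowerSeries.coeff_mul, PowerSeries.coeff_mul]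
  refine Finset.sum_congr rfl fun p hp ↦ ?_
  rw [HasAntidiagonal.mem_antidiagonal] at hp
  rw [hxg _ _ (by omega), hyh _ _ (by omega)]

lemma StabilizesInAlgebra.smul {x : ℕ → PowerSeries ℚ} (hx : StabilizesInAlgebra x) (c : ℚ) :
    StabilizesInAlgebra fun K ↦ c • x K := by
  obtain ⟨g, hg, hxg⟩ := hx
  refine ⟨c • g, Subalgebra.smul_mem _ hg _, fun n K hn ↦ ?_⟩
  rw [PowerSeries.coeff_smul, PowerSeries.coeff_smul, hxg n K hn]

lemma StabilizesInAlgebra.sum {ι : Type*} {s : Finset ι} {x : ι → ℕ → PowerSeries ℚ}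
    (hx : ∀ i ∈ s, StabilizesInAlgebra (x i)) : StabilizesInAlgebra fun K ↦ ∑ i ∈ s, x i K := by
  choose! g hg hxg using hx
  refine ⟨∑ i ∈ s, g i, Subalgebra.sum_mem _ hg, fun n K hn ↦ ?_⟩
  rw [map_sum, map_sum]
  exact Finset.sum_congr rfl fun i hi ↦ hxg i hi n K hn

lemma stabilizesInAlgebra_powerSum {r : ℕ} (hr : 1 ≤ r) :
    StabilizesInAlgebra (powerSum macMahonTerm r) :=
  ⟨_, divisorSeries_choose_mem hr, fun _ _ hn ↦ coeff_powerSum_macMahonTerm hr hn⟩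

/-- A sequence of sequences determined by Newton-type identities stabilises in the quasimodular
algebra. -/
lemma stabilizesInAlgebra_of_newton {e : ℕ → ℕ → PowerSeries ℚ} (c : ℚ) (h0 : ∀ K, e 0 K = 1)
    (h : ∀ a K : ℕ, ((a : PowerSeries ℚ) + 1) * e (a + 1) K =
      ∑ x ∈ antidiagonal a, e x.1 K * (c ^ x.2 • powerSum macMahonTerm (x.2 + 1) K)) (a : ℕ) :
    StabilizesInAlgebra (e a) := by
  induction a using Nat.strong_induction_on with
  | _ a ih =>
    cases a with
    | zero =>
      rw [show e 0 = fun _ ↦ 1 from funext h0]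
      exact stabilizesInAlgebra_one
    | succ a =>
      have hne : (a : ℚ) + 1 ≠ 0 := by positivity
      have he : e (a + 1) = fun K ↦ ((a : ℚ) + 1)⁻¹ •
          ∑ x ∈ antidiagonal a, e x.1 K * (c ^ x.2 • powerSum macMahonTerm (x.2 + 1) K) := by
        funext K
        rw [← h, eq_inv_smul_iff₀ hne, add_smul, add_mul, one_smul, one_mul, Nat.cast_smul_eq_nsmul,
          nsmul_eq_mul]
      rw [he]
      refine StabilizesInAlgebra.smul (StabilizesInAlgebra.sum fun x hx ↦
        StabilizesInAlgebra.mul (ih x.1 ?_)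
          ((stabilizesInAlgebra_powerSum (Nat.le_add_left 1 x.2)).smul _)) _
      rw [HasAntidiagonal.mem_antidiagonal] at hx
      omega

lemma stabilizesInAlgebra_elementarySum (a : ℕ) :
    StabilizesInAlgebra (elementarySum macMahonTerm a) := by
  refine stabilizesInAlgebra_of_newton (-1) (fun K ↦ by simp [elementarySum]) (fun a K ↦ ?_) a
  rw [succ_mul_elementarySum]
  refine Finset.sum_congr rfl fun x _ ↦ ?_
  rw [PowerSeries.smul_eq_C_mul]
  simp

lemma stabilizesInAlgebra_completeSum (a : ℕ) :
    StabilizesInAlgebra (completeSum macMahonTerm a) := by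
  refine stabilizesInAlgebra_of_newton 1 (fun K ↦ by simp [completeSum]) (fun a K ↦ ?_) a
  rw [succ_mul_completeSum]
  simp

end QuasiModular

/-- The terms `s * q ^ (s * k)` of `macMahonTerm k` with `s ≤ n`. -/
noncomputable def truncMacMahonTerm (n k : ℕ) : PowerSeries ℚ :=
  ∑ s ∈ range (n + 1), PowerSeries.C (if k = 0 then 0 else (s : ℚ)) * PowerSeries.X ^ (s * k)

lemma coeff_truncMacMahonTerm {n i : ℕ} (hi : i < n + 1) (k : ℕ) :
    PowerSeries.coeff i (truncMacMahonTerm n k) = PowerSeries.coeff i (macMahonTerm k) := by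
  rw [truncMacMahonTerm, macMahonTerm, PowerSeries.coeff_mk, map_sum]
  simp only [PowerSeries.coeff_C_mul_X_pow]
  rcases eq_or_ne k 0 with rfl | hk
  · simp
  simp only [if_neg hk]
  split_ifs with h
  · obtain ⟨d, rfl⟩ := h
    have hd : d ∈ range (n + 1) :=
      mem_range.mpr ((Nat.le_mul_of_pos_left d (Nat.pos_of_ne_zero hk)).trans_lt hi)
    rw [Nat.mul_div_cancel_left d (Nat.pos_of_ne_zero hk), Finset.sum_eq_single_of_mem d hd]
    · rw [if_pos (mul_comm k d)]
    · intro b _ hb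
      refine if_neg fun h ↦ hb ?_
      rw [mul_comm k d] at h
      exact (Nat.eq_of_mul_eq_mul_right (Nat.pos_of_ne_zero hk) h).symm
  · refine Finset.sum_eq_zero fun s _ ↦ if_neg ?_
    rintro rfl
    exact h (dvd_mul_left k s)

/-- An expression in power series compatible with ring homomorphisms has coefficient of degree
`n` depending only on the coefficients of its arguments of degree at most `n`. -/
lemma coeff_eq_of_map_eq {n : ℕ} {e e' : PowerSeries ℚ} {y y' : ℕ → PowerSeries ℚ}
    (hy : ∀ k i, i < n + 1 → PowerSeries.coeff i (y k) = PowerSeries.coeff i (y' k))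
    (he : let φ := Ideal.Quotient.mk (Ideal.span {(PowerSeries.X : PowerSeries ℚ) ^ (n + 1)})
      φ ∘ y = φ ∘ y' → φ e = φ e') :
    PowerSeries.coeff n e = PowerSeries.coeff n e' := by
  have h := he (funext fun k ↦ Ideal.Quotient.eq.mpr (Ideal.mem_span_singleton.mpr
    (PowerSeries.X_pow_dvd_iff.mpr fun i hi ↦ by rw [map_sub, hy k i hi, sub_self])))
  have h1 := PowerSeries.X_pow_dvd_iff.mp (Ideal.mem_span_singleton.mp (Ideal.Quotient.eq.mp h))
    n (Nat.lt_succ_self n)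
  rwa [map_sub, sub_eq_zero] at h1

lemma coeff_prod_truncMacMahonTerm {a : ℕ} (n : ℕ) (k : Fin a → ℕ) :
    PowerSeries.coeff n (∏ i, truncMacMahonTerm n (k i)) =
      ∑ s ∈ (Fintype.piFinset fun _ : Fin a ↦ range (n + 1)) with ∑ i, s i * k i = n,
        ∏ i, if k i = 0 then 0 else (s i : ℚ) := by
  simp only [truncMacMahonTerm]
  rw [Finset.prod_univ_sum, map_sum, Finset.sum_filter]
  refine Finset.sum_congr rfl fun s _ ↦ ?_
  rw [Finset.prod_mul_distrib, ← map_prod, Finset.prod_pow_eq_pow_sum,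
    PowerSeries.coeff_C_mul_X_pow]
  simp only [eq_comm]

lemma coeff_sum_prod_truncMacMahonTerm {a n : ℕ} {T : (Fin a → ℕ) → Prop} [DecidablePred T]
    {P : (Fin a → Fin (n + 1) × Fin (n + 1)) → Prop} [DecidablePred P]
    (hP : ∀ f, P f ↔ (∀ i, 0 < ((f i).1 : ℕ) ∧ 0 < ((f i).2 : ℕ)) ∧
      T (fun i ↦ (f i).1) ∧ ∑ i, ((f i).2 : ℕ) * ((f i).1 : ℕ) = n) :
    PowerSeries.coeff n (∑ k ∈ (Fintype.piFinset fun _ : Fin a ↦ range (n + 1)) with T k,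
        ∏ i, truncMacMahonTerm n (k i)) =
      ((∑ f with P f, ∏ i, ((f i).2 : ℕ) : ℕ) : ℚ) := by
  simp only [map_sum, coeff_prod_truncMacMahonTerm]
  have h1 : ((∑ f with P f, ∏ i, ((f i).2 : ℕ) : ℕ) : ℚ) =
      ∑ f : Fin a → Fin (n + 1) × Fin (n + 1) with
        T (fun i ↦ (f i).1) ∧ ∑ i, ((f i).2 : ℕ) * ((f i).1 : ℕ) = n,
        ∏ i, if ((f i).1 : ℕ) = 0 then 0 else (((f i).2 : ℕ) : ℚ) := by
    push_cast
    rw [Finset.sum_filter, Finset.sum_filter]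
    refine Finset.sum_congr rfl fun f _ ↦ ?_
    by_cases hpos : ∀ i, 0 < ((f i).1 : ℕ) ∧ 0 < ((f i).2 : ℕ)
    · refine if_congr (by rw [hP, and_iff_right hpos]) (Finset.prod_congr rfl fun i _ ↦ ?_) rfl
      rw [if_neg (hpos i).1.ne']
    · rw [if_neg fun h ↦ hpos ((hP f).mp h).1]
      obtain ⟨i, hi⟩ := not_forall.mp hpos
      rw [Finset.prod_eq_zero (mem_univ i), ite_self]
      split_ifs with h
      · rfl
      · have h2 : ((f i).2 : ℕ) = 0 := by omega
        rw [h2, Nat.cast_zero]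
  rw [h1, Finset.sum_sigma']
  refine Finset.sum_nbij' (fun p i ↦ (Fin.ofNat (n + 1) (p.1 i), Fin.ofNat (n + 1) (p.2 i)))
    (fun f ↦ ⟨fun i ↦ (f i).1, fun i ↦ (f i).2⟩) ?_ ?_ ?_ ?_ ?_
  · rintro ⟨k, s⟩ h
    simp only [mem_sigma, mem_filter, Fintype.mem_piFinset, mem_range] at h
    simp only [mem_filter, mem_univ, true_and, Fin.val_ofNat, Nat.mod_eq_of_lt (h.1.1 _),
      Nat.mod_eq_of_lt (h.2.1 _)]
    exact ⟨h.1.2, h.2.2⟩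
  · intro f h
    simp only [mem_filter, mem_univ, true_and] at h
    simp only [mem_sigma, mem_filter, Fintype.mem_piFinset, mem_range]
    exact ⟨⟨fun i ↦ (f i).1.2, h.1⟩, fun i ↦ (f i).2.2, h.2⟩
  · rintro ⟨k, s⟩ h
    simp only [mem_sigma, mem_filter, Fintype.mem_piFinset, mem_range] at h
    simp only [Fin.val_ofNat, Nat.mod_eq_of_lt (h.1.1 _), Nat.mod_eq_of_lt (h.2.1 _)]
  · intro f _
    funext i
    ext <;> simp
  · rintro ⟨k, s⟩ h
    simp only [mem_sigma, mem_filter, Fintype.mem_piFinset, mem_range] at h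
    simp only [Fin.val_ofNat, Nat.mod_eq_of_lt (h.1.1 _), Nat.mod_eq_of_lt (h.2.1 _)]

lemma coeff_elementarySum_macMahonTerm (a n : ℕ) :
    PowerSeries.coeff n (elementarySum macMahonTerm a (n + 1)) = (MO a n : ℚ) := by
  rw [MO]
  refine Eq.trans ?_ (coeff_sum_prod_truncMacMahonTerm
    (T := fun k ↦ ∀ i j, i < j → k i < k j) fun f ↦ Iff.rfl)
  rw [sum_strictMono_eq_elementarySum]
  refine (coeff_eq_of_map_eq (fun k i hi ↦ coeff_truncMacMahonTerm hi k) fun h ↦ ?_).symm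
  rw [map_elementarySum, map_elementarySum, h]

lemma coeff_completeSum_macMahonTerm (a n : ℕ) :
    PowerSeries.coeff n (completeSum macMahonTerm a (n + 1)) = (M a n : ℚ) := by
  rw [M]
  refine Eq.trans ?_ (coeff_sum_prod_truncMacMahonTerm
    (T := fun k ↦ ∀ i j, i ≤ j → k i ≤ k j) fun f ↦ Iff.rfl)
  rw [sum_monotone_eq_completeSum]
  refine (coeff_eq_of_map_eq (fun k i hi ↦ coeff_truncMacMahonTerm hi k) fun h ↦ ?_).symm
  rw [map_completeSum, map_completeSum, h]

namespace QuasiModular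

theorem exists_mem_coeff_eq_MO (a : ℕ) :
    ∃ g ∈ quasiModularAlgebra, ∀ n, PowerSeries.coeff n g = (MO a n : ℚ) := by
  obtain ⟨g, hg, h⟩ := stabilizesInAlgebra_elementarySum a
  exact ⟨g, hg, fun n ↦ by
    rw [← h n (n + 1) (Nat.lt_succ_self n), coeff_elementarySum_macMahonTerm]⟩

theorem exists_mem_coeff_eq_M (a : ℕ) :
    ∃ g ∈ quasiModularAlgebra, ∀ n, PowerSeries.coeff n g = (M a n : ℚ) := by
  obtain ⟨g, hg, h⟩ := stabilizesInAlgebra_completeSum a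
  exact ⟨g, hg, fun n ↦ by
    rw [← h n (n + 1) (Nat.lt_succ_self n), coeff_completeSum_macMahonTerm]⟩

end QuasiModular

lemma dvd_of_AP_subset {p q : ℕ × ℕ} (h : AP p ⊆ AP q) : q.1 ∣ p.1 := by
  obtain ⟨x, hx⟩ := h ⟨0, rfl⟩
  obtain ⟨y, hy⟩ := h ⟨1, rfl⟩
  refine (Nat.dvd_add_right (dvd_mul_right q.1 x)).mp ⟨y, ?_⟩
  omega

/-- for positive integers `a` and `m` there are infinitely many pairwise
non-nested arithmetic progressions `t*n + r` on which both `M (a; ·)` and `MO (a; ·)`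
vanish mod `m`. -/
theorem M_MO_simultaneous_congruences (a m : ℕ) (ha : 0 < a) (hm : 0 < m) :
    ∃ S : Set (ℕ × ℕ), S.Infinite ∧
      (∀ p ∈ S, p.2 < p.1) ∧
      (∀ p ∈ S, ∀ n : ℕ, m ∣ M a (p.1 * n + p.2) ∧ m ∣ MO a (p.1 * n + p.2)) ∧
      (∀ p ∈ S, ∀ q ∈ S, p ≠ q → ¬ AP p ⊆ AP q) := by
  obtain ⟨g, hg, hgM⟩ := QuasiModular.exists_mem_coeff_eq_M a
  obtain ⟨h, hh, hhM⟩ := QuasiModular.exists_mem_coeff_eq_MO a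
  obtain ⟨B, hB⟩ := QuasiModular.hasHeckePeriods_of_mem hg m hm
  obtain ⟨C, hC⟩ := QuasiModular.hasHeckePeriods_of_mem hh m hm
  have key : ∀ ℓ : {ℓ : ℕ | ℓ.Prime ∧ max B C < ℓ}, ∃ N, ∀ n,
      m ∣ M a ((ℓ : ℕ) ^ (N + 1) * n + (ℓ : ℕ) ^ N) ∧
        m ∣ MO a ((ℓ : ℕ) ^ (N + 1) * n + (ℓ : ℕ) ^ N) := by
    rintro ⟨ℓ, hℓ, hlt⟩
    obtain ⟨N, hN, hgN⟩ := hB ℓ hℓ (lt_of_le_of_lt (le_max_left _ _) hlt)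
    obtain ⟨N', hN', hhN⟩ := hC ℓ hℓ (lt_of_le_of_lt (le_max_right _ _) hlt)
    obtain ⟨K, hK⟩ : ∃ K, N' * N = K + 1 :=
      ⟨N' * N - 1, by have := Nat.mul_pos hN' hN; omega⟩
    refine ⟨K, fun n ↦ ?_⟩
    have hn : ¬ ℓ ∣ ℓ * n + 1 := fun h1 ↦
      hℓ.one_lt.ne' (Nat.dvd_one.mp ((Nat.dvd_add_right (dvd_mul_right ℓ n)).mp h1))
    rw [show ℓ ^ (K + 1) * n + ℓ ^ K = ℓ ^ K * (ℓ * n + 1) by ring]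
    obtain ⟨z, hz⟩ := hgN N' hN' _ hn
    obtain ⟨w, hw⟩ := hhN N hN _ hn
    rw [hK, Nat.add_sub_cancel, hgM] at hz
    rw [mul_comm N N', hK, Nat.add_sub_cancel, hhM] at hw
    exact ⟨Int.natCast_dvd_natCast.mp ⟨z, by exact_mod_cast hz⟩,
      Int.natCast_dvd_natCast.mp ⟨w, by exact_mod_cast hw⟩⟩
  choose N hN using key
  have hprime : ∀ ℓ ℓ' : {ℓ : ℕ | ℓ.Prime ∧ max B C < ℓ},
      (ℓ : ℕ) ^ (N ℓ + 1) ∣ (ℓ' : ℕ) ^ (N ℓ' + 1) → ℓ = ℓ' := fun ℓ ℓ' hd ↦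
    Subtype.ext ((Nat.prime_dvd_prime_iff_eq ℓ.2.1 ℓ'.2.1).mp
      (ℓ.2.1.dvd_of_dvd_pow ((dvd_pow_self _ (Nat.succ_ne_zero _)).trans hd)))
  have : Infinite {ℓ : ℕ | ℓ.Prime ∧ max B C < ℓ} := by
    refine (Set.infinite_of_forall_exists_gt fun x ↦ ?_).to_subtype
    obtain ⟨ℓ, hle, hℓ⟩ := Nat.exists_infinite_primes (max x (max B C) + 1)
    exact ⟨ℓ, ⟨hℓ, by omega⟩, by omega⟩
  refine ⟨Set.range fun ℓ : {ℓ : ℕ | ℓ.Prime ∧ max B C < ℓ} ↦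
    ((ℓ : ℕ) ^ (N ℓ + 1), (ℓ : ℕ) ^ N ℓ), Set.infinite_range_of_injective ?_, ?_, ?_, ?_⟩
  · exact fun ℓ ℓ' he ↦ hprime ℓ ℓ' (congrArg Prod.fst he).dvd
  · rintro _ ⟨ℓ, rfl⟩
    exact Nat.pow_lt_pow_right ℓ.2.1.one_lt (Nat.lt_succ_self _)
  · rintro _ ⟨ℓ, rfl⟩
    exact hN ℓ
  · rintro _ ⟨ℓ, rfl⟩ _ ⟨ℓ', rfl⟩ hne hsub
    rw [hprime ℓ' ℓ (dvd_of_AP_subset hsub)] at hne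
    exact hne rfl
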